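/- arXiv:2204.07505 — 2 statements merged into one kernel-verified Lean document; each statement's English description precedes it below -/
import Mathlib

section
/- (Theorem 1.1, item 4.) Let {y_k(x,ρ)}_{k=1,…,n} be the fundamental system of solutions constructed in Theorem 1.1. Then as |ρ| → ∞, ρ ∈ S̄, uniformly in x ∈ [α,T], det[y_k^{(ν−1)}(x,ρ)]_{ν,k=1,…,n} = ρ^{n(n−1)/2} · det[R_k^{ν−1}]_{ν,k=1,…,n} · (1 + o(1/ρ)). -/
open MeasureTheory Set Finset

/-- `ρ_α := max_{0≤m≤n−2} (2∫_α^T |p_m(t)| dt)^{1/(n−1−m)}`. -/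
noncomputable def rhoAlpha (n : ℕ) (T α : ℝ) (p : Fin (n - 1) → ℝ → ℂ) : ℝ :=
  ⨆ m : Fin (n - 1), (2 * ∫ t in α..T, ‖p m t‖) ^ (((n : ℝ) - 1 - (m : ℕ))⁻¹)

/-- `d : ℕ → ℝ → ℂ` is the derivative tower of a solution `y = d 0` of equation (1.1),
`y^{(n)} + Σ_{m=0}^{n−2} p_m(x) y^{(m)} = ρ^n y`, on `[0,T]`: `d ν` has derivative
`d (ν+1)` on `[0,T]` for `ν < n−1`, `d (n−1)` is absolutely continuous with integrable
a.e. derivative `d n`, and the equation holds a.e. on `[0,T]`. -/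
def IsSolutionODE (n : ℕ) (T : ℝ) (p : Fin (n - 1) → ℝ → ℂ) (ρ : ℂ)
    (d : ℕ → ℝ → ℂ) : Prop :=
  (∀ ν < n - 1, ∀ x ∈ Set.Icc (0 : ℝ) T,
      HasDerivWithinAt (d ν) (d (ν + 1) x) (Set.Icc (0 : ℝ) T) x) ∧
  IntervalIntegrable (d n) volume 0 T ∧
  (∀ x ∈ Set.Icc (0 : ℝ) T, d (n - 1) x = d (n - 1) 0 + ∫ t in (0 : ℝ)..x, d n t) ∧
  (∀ᵐ x ∂(volume.restrict (Set.Icc (0 : ℝ) T)),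
      d n x + ∑ m : Fin (n - 1), p m x * d (m : ℕ) x = ρ ^ n * d 0 x)


/-- An injective family of `n` roots of unity of order `n` exhausts all of them. -/
theorem image_eq_nthRootsFinset {n : ℕ} (hn : 0 < n) {R : Fin n → ℂ}
    (hinj : Function.Injective R) (hroot : ∀ j, R j ^ n = 1) :
    Finset.univ.image R = Polynomial.nthRootsFinset n 1 := by
  apply Finset.eq_of_subset_of_card_le
  · intro z hz
    obtain ⟨j, -, rfl⟩ := Finset.mem_image.1 hz
    exact (Polynomial.mem_nthRootsFinset hn 1).2 (hroot j)
  · rw [(Complex.isPrimitiveRoot_exp n hn.ne').card_nthRootsFinset,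
      Finset.card_image_of_injective _ hinj]
    simp

theorem prod_one_add_mul_roots_of_unity {n : ℕ} (hn : 0 < n) {R : Fin n → ℂ}
    (hinj : Function.Injective R) (hroot : ∀ j, R j ^ n = 1) (c : ℂ) :
    ∏ k, (1 + c * R k) = 1 - (-c) ^ n := by
  have h := (Complex.isPrimitiveRoot_exp n hn.ne').pow_sub_pow_eq_prod_sub_mul 1 (-c) hn
  rw [← image_eq_nthRootsFinset hn hinj hroot, Finset.prod_image (fun _ _ _ _ h => hinj h)] at h
  rw [one_pow] at h
  rw [h]
  exact Finset.prod_congr rfl fun k _ => by ring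

theorem sum_roots_of_unity_eq_zero {n : ℕ} (hn : 2 ≤ n) {R : Fin n → ℂ}
    (hinj : Function.Injective R) (hroot : ∀ j, R j ^ n = 1) : ∑ k, R k = 0 := by
  have hn0 : 0 < n := by omega
  have hζ := Complex.isPrimitiveRoot_exp n hn0.ne'
  set ζ := Complex.exp (2 * Real.pi * Complex.I / n)
  have hζi : Function.Injective fun j : Fin n => ζ ^ (j : ℕ) := fun i j h =>
    Fin.ext (hζ.pow_inj i.2 j.2 h)
  have hζr : ∀ j : Fin n, (ζ ^ (j : ℕ)) ^ n = 1 := fun j => by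
    rw [← pow_mul, mul_comm, pow_mul, hζ.pow_eq_one, one_pow]
  have sum_eq {r : Fin n → ℂ} (hr : Function.Injective r) (hr1 : ∀ j, r j ^ n = 1) :
      ∑ k, r k = ∑ z ∈ Polynomial.nthRootsFinset n (1 : ℂ), z := by
    rw [← image_eq_nthRootsFinset hn0 hr hr1, Finset.sum_image (fun _ _ _ _ h => hr h)]
  rw [sum_eq hinj hroot, ← sum_eq hζi hζr, Fin.sum_univ_eq_sum_range (fun i => ζ ^ i) n,
    hζ.geom_sum_eq_zero (by omega)]

/-- The determinant is Lipschitz, with respect to the entrywise sup norm, on sets of matrices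
with bounded entries. -/
theorem exists_norm_det_sub_det_le (n : ℕ) {C : ℝ} (hC : 0 ≤ C) :
    ∃ K : ℝ, 0 ≤ K ∧ ∀ A B : Matrix (Fin n) (Fin n) ℂ, ∀ δ : ℝ, 0 ≤ δ →
      (∀ i j, ‖A i j‖ ≤ C) → (∀ i j, ‖B i j‖ ≤ C) → (∀ i j, ‖B i j - A i j‖ ≤ δ) →
      ‖B.det - A.det‖ ≤ K * δ := by
  let f : MultilinearMap ℂ (fun _ : Fin n => Fin n → ℂ) ℂ :=
    (Matrix.detRowAlternating (n := Fin n) (R := ℂ)).toMultilinearMap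
  have hf : Continuous f := Continuous.matrix_det (A := fun A : Matrix (Fin n) (Fin n) ℂ => A)
    continuous_id
  obtain ⟨D, hD, hfD⟩ := f.exists_bound_of_continuous hf
  refine ⟨D * n * C ^ (n - 1), by positivity, fun A B δ hδ hA hB hAB => ?_⟩
  have key := f.norm_image_sub_le_of_bound hD.le hfD B A
  rw [Fintype.card_fin] at key
  have entry {M : Fin n → Fin n → ℂ} {r : ℝ} (hr : 0 ≤ r) (hM : ∀ i j, ‖M i j‖ ≤ r) :
      ‖M‖ ≤ r :=
    (pi_norm_le_iff_of_nonneg hr).2 fun i => (pi_norm_le_iff_of_nonneg hr).2 (hM i)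
  refine key.trans ?_
  have h0 := (norm_nonneg (E := Fin n → Fin n → ℂ) B).trans
    (le_max_left _ (norm (E := Fin n → Fin n → ℂ) A))
  have h1 := max_le (entry hC hB) (entry hC hA)
  have h2 := entry (M := fun i j => B i j - A i j) hδ hAB
  exact mul_le_mul (mul_le_mul_of_nonneg_left (pow_le_pow_left₀ h0 h1 _) (by positivity)) h2
    (norm_nonneg _) (by positivity)

/-- A uniform bound for the partial integrals of an integrable function. -/
theorem exists_norm_integral_le {T α : ℝ} (hα : α ∈ Set.Ico 0 T) {f : ℝ → ℂ}
    (hf : IntervalIntegrable f volume 0 T) :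
    ∃ b : ℝ, 0 ≤ b ∧ ∀ x ∈ Set.Icc α T, ‖∫ t in α..x, f t‖ ≤ b := by
  refine ⟨∫ t in (0 : ℝ)..T, ‖f t‖,
    intervalIntegral.integral_nonneg (hα.1.trans hα.2.le) fun _ _ => norm_nonneg _,
    fun x hx => ?_⟩
  exact (intervalIntegral.norm_integral_le_integral_norm hx.1).trans
    (intervalIntegral.integral_mono_interval hα.1 hx.1 hx.2
      (Filter.Eventually.of_forall fun _ => norm_nonneg _) hf.norm)

/-- The weights `ρ ^ ν` and `exp (ρ R_k x)` factor out of a determinant; the exponentials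
cancel when the `R_k` sum to zero. -/
theorem det_pow_mul_exp_mul {n : ℕ} {R : Fin n → ℂ} (hR : ∑ k, R k = 0) (ρ x : ℂ)
    (B : Matrix (Fin n) (Fin n) ℂ) :
    (Matrix.of fun ν k : Fin n => ρ ^ (ν : ℕ) * (Complex.exp (ρ * R k * x) * B ν k)).det =
      ρ ^ (n * (n - 1) / 2) * B.det := by
  have h := Matrix.det_mul_column (fun ν : Fin n => ρ ^ (ν : ℕ))
    (Matrix.of fun ν k : Fin n => Complex.exp (ρ * R k * x) * B ν k)
  simp only [Matrix.of_apply] at h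
  rw [h, Matrix.det_mul_row (fun k : Fin n => Complex.exp (ρ * R k * x)) B, ← Complex.exp_sum,
    ← Finset.sum_mul, ← Finset.mul_sum, hR, Finset.prod_pow_eq_pow_sum,
    Fin.sum_univ_eq_sum_range (fun i => i) n, Finset.sum_range_id]
  simp

/-- Theorem 1.1, item 4.  If `Y k ρ ν x = y_k^{(ν)}(x,ρ)` is the
fundamental system of solutions constructed in Theorem 1.1 — i.e. each `y_k(·,ρ)` solves
(1.1) and satisfies the asymptotics
`y_k^{(ν)}(x,ρ) = (ρR_k)^ν e^{ρR_k x}(1 + β₁(x)/(ρR_k) + o(1/ρ))` uniformly in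
`x ∈ [α,T]` — then, uniformly in `x ∈ [α,T]`, as `|ρ| → ∞`, `ρ ∈ S̄`,
`det[y_k^{(ν−1)}(x,ρ)] = ρ^{n(n−1)/2} · det[R_k^{ν−1}] · (1 + o(1/ρ))`. -/
theorem birkhoff_fss_wronskian_asymptotics (n : ℕ) (hn : 2 ≤ n) (T α : ℝ) (hT : 0 < T)
    (hα : α ∈ Set.Ico 0 T)
    (R : Fin n → ℂ) (hinj : Function.Injective R) (hroot : ∀ j, R j ^ n = 1)
    (p : Fin (n - 1) → ℝ → ℂ)
    (hp : ∀ m, IntervalIntegrable (p m) volume 0 T)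
    (S : Set ℂ) (hS : IsOpen S)
    (hord : ∀ ρ ∈ S, ∀ k l : Fin n, k < l → (ρ * R k).re < (ρ * R l).re)
    (Y : Fin n → ℂ → ℕ → ℝ → ℂ)
    (hsol : ∀ k : Fin n, ∀ ρ ∈ closure S, rhoAlpha n T α p ≤ ‖ρ‖ →
        IsSolutionODE n T p ρ (Y k ρ))
    (hfss : ∀ ρ ∈ closure S, rhoAlpha n T α p ≤ ‖ρ‖ → ∀ x ∈ Set.Icc (0 : ℝ) T,
        (Matrix.of fun ν k : Fin n => Y k ρ (ν : ℕ) x).det ≠ 0)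
    (hasymp : ∀ ε > (0 : ℝ), ∃ ρ₀ : ℝ, ∀ ρ ∈ closure S, rhoAlpha n T α p ≤ ‖ρ‖ →
        ρ₀ ≤ ‖ρ‖ → ∀ k : Fin n, ∀ ν < n, ∀ x ∈ Set.Icc α T,
          ‖Y k ρ ν x - (ρ * R k) ^ ν * Complex.exp (ρ * R k * x) *
              (1 + (-(1 / (n : ℂ)) * ∫ t in α..x, p ⟨n - 2, by omega⟩ t) / (ρ * R k))‖
            ≤ ε * ‖(ρ * R k) ^ ν * Complex.exp (ρ * R k * x)‖ / ‖ρ‖) :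
    ∀ ε > (0 : ℝ), ∃ ρ₀ : ℝ, ∀ ρ ∈ closure S, rhoAlpha n T α p ≤ ‖ρ‖ → ρ₀ ≤ ‖ρ‖ →
      ∀ x ∈ Set.Icc α T,
        ‖(Matrix.of fun ν k : Fin n => Y k ρ (ν : ℕ) x).det -
            ρ ^ (n * (n - 1) / 2) * (Matrix.of fun ν k : Fin n => R k ^ (ν : ℕ)).det‖
          ≤ ε * ‖ρ ^ (n * (n - 1) / 2) *
              (Matrix.of fun ν k : Fin n => R k ^ (ν : ℕ)).det‖ / ‖ρ‖ := by
  have hn0 : 0 < n := by omega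
  have hR1 : ∀ k, ‖R k‖ = 1 := fun k => Complex.norm_eq_one_of_pow_eq_one (hroot k) hn0.ne'
  have hR0 : ∀ k, R k ≠ 0 := fun k h => by simpa [h] using hR1 k
  set V : Matrix (Fin n) (Fin n) ℂ := Matrix.of fun ν k : Fin n => R k ^ (ν : ℕ) with hV
  have hV0 : 0 < ‖V.det‖ := by
    have h : V = (Matrix.vandermonde R).transpose := by
      ext i j
      simp [hV, Matrix.vandermonde_apply]
    rw [norm_pos_iff, h, Matrix.det_transpose]
    exact Matrix.det_vandermonde_ne_zero_iff.2 hinj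
  obtain ⟨b₀, hb₀, hint⟩ := exists_norm_integral_le hα (hp ⟨n - 2, by omega⟩)
  set β : ℝ → ℂ := fun x => -(1 / (n : ℂ)) * ∫ t in α..x, p ⟨n - 2, by omega⟩ t with hβ
  obtain ⟨b, hb, hβb⟩ : ∃ b : ℝ, 0 ≤ b ∧ ∀ x ∈ Set.Icc α T, ‖β x‖ ≤ b := by
    refine ⟨‖-(1 / (n : ℂ))‖ * b₀, by positivity, fun x hx => ?_⟩
    rw [hβ, norm_mul]
    exact mul_le_mul_of_nonneg_left (hint x hx) (norm_nonneg _)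
  obtain ⟨K, hK, hdet⟩ := exists_norm_det_sub_det_le n (C := 2 + b) (by positivity)
  intro ε hε
  set δ : ℝ := min 1 (ε * ‖V.det‖ / (2 * (K + 1)))
  have hδ : 0 < δ := lt_min one_pos (by positivity)
  have hδ1 : δ ≤ 1 := min_le_left _ _
  have hKδ : K * δ ≤ ε * ‖V.det‖ / 2 := by
    have h : δ ≤ ε * ‖V.det‖ / (2 * (K + 1)) := min_le_right _ _
    rw [le_div_iff₀ (by positivity)] at h
    nlinarith
  obtain ⟨ρ₀, hρ₀⟩ := hasymp δ hδ
  refine ⟨max ρ₀ (max 1 (2 * b ^ n / ε)), fun ρ hρS hρα hρ x hx => ?_⟩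
  have hρ1 : 1 ≤ ‖ρ‖ := (le_max_left _ _).trans ((le_max_right _ _).trans hρ)
  have hρb : 2 * b ^ n / ε ≤ ‖ρ‖ := (le_max_right _ _).trans ((le_max_right _ _).trans hρ)
  have hρpos : 0 < ‖ρ‖ := one_pos.trans_le hρ1
  have hρne : ρ ≠ 0 := norm_pos_iff.1 hρpos
  have has := fun k (ν : Fin n) => hρ₀ ρ hρS hρα ((le_max_left _ _).trans hρ) k ν ν.2 x hx
  set c : ℂ := β x / ρ with hc
  have hcb : ‖c‖ ≤ b / ‖ρ‖ := by
    rw [hc, norm_div]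
    exact div_le_div_of_nonneg_right (hβb x hx) hρpos.le
  have hcb' : ‖c‖ ≤ b := hcb.trans (div_le_self hb hρ1)
  set A : Matrix (Fin n) (Fin n) ℂ := Matrix.of fun ν k =>
    (1 + c * (R k)⁻¹) * V ν k with hA
  set B : Matrix (Fin n) (Fin n) ℂ := Matrix.of fun ν k =>
    (ρ ^ (ν : ℕ))⁻¹ * (Complex.exp (ρ * R k * x))⁻¹ * Y k ρ ν x with hB
  have hAdet : A.det = (1 - (-c) ^ n) * V.det := by
    rw [hA, Matrix.det_mul_row, prod_one_add_mul_roots_of_unity hn0 (R := fun k => (R k)⁻¹)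
      (inv_injective.comp hinj) (fun j => by simp [hroot j])]
  have hYdet : (Matrix.of fun ν k : Fin n => Y k ρ (ν : ℕ) x).det =
      ρ ^ (n * (n - 1) / 2) * B.det := by
    rw [← det_pow_mul_exp_mul (sum_roots_of_unity_eq_zero hn hinj hroot) ρ x B]
    congr 1
    ext ν k
    have := pow_ne_zero (ν : ℕ) hρne
    have := Complex.exp_ne_zero (ρ * R k * x)
    simp only [hB, Matrix.of_apply]
    field_simp
  have hAB : ∀ ν k, ‖B ν k - A ν k‖ ≤ δ / ‖ρ‖ := fun ν k => by
    set w : ℂ := ρ ^ (ν : ℕ) * Complex.exp (ρ * R k * x) with hw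
    have hw0 : w ≠ 0 := mul_ne_zero (pow_ne_zero _ hρne) (Complex.exp_ne_zero _)
    have h := has k ν
    have h1 : (ρ * R k) ^ (ν : ℕ) * Complex.exp (ρ * R k * x) = w * R k ^ (ν : ℕ) := by
      rw [hw, mul_pow]
      ring
    have h2 : Y k ρ ν x - w * R k ^ (ν : ℕ) * (1 + β x / (ρ * R k)) =
        w * (B ν k - A ν k) := by
      have hBν : B ν k = w⁻¹ * Y k ρ ν x := by simp [hB, hw, mul_comm]
      rw [hBν, mul_sub, mul_inv_cancel_left₀ hw0]
      simp only [hA, hV, hc, Matrix.of_apply]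
      have := hR0 k
      field_simp
    rw [h1] at h
    rw [h2, norm_mul w, norm_mul w, norm_pow, hR1, one_pow, mul_one] at h
    have hwpos : 0 < ‖w‖ := norm_pos_iff.2 hw0
    refine le_of_mul_le_mul_left (h.trans_eq ?_) hwpos
    ring
  have hAC : ∀ ν k, ‖A ν k‖ ≤ 1 + b := fun ν k => by
    simp only [hA, hV, Matrix.of_apply, norm_mul, norm_pow, hR1, one_pow, mul_one]
    refine (norm_add_le _ _).trans ?_
    simpa [hR1] using hcb'
  have hBC : ∀ ν k, ‖B ν k‖ ≤ 2 + b := fun ν k => by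
    have h1 := norm_add_le (A ν k) (B ν k - A ν k)
    rw [add_sub_cancel] at h1
    have h2 : δ / ‖ρ‖ ≤ 1 := (div_le_self hδ.le hρ1).trans hδ1
    linarith [hAC ν k, hAB ν k]
  have hBA := hdet A B (δ / ‖ρ‖) (by positivity) (fun ν k => (hAC ν k).trans (by linarith))
    hBC hAB
  have hAV : ‖A.det - V.det‖ ≤ ε * ‖V.det‖ / 2 / ‖ρ‖ := by
    have h1 : A.det - V.det = -((-c) ^ n) * V.det := by
      rw [hAdet]
      ring
    have h2 : ‖c‖ ^ n ≤ ε / 2 / ‖ρ‖ := by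
      calc ‖c‖ ^ n ≤ (b / ‖ρ‖) ^ n := pow_le_pow_left₀ (norm_nonneg _) hcb n
        _ = b ^ n / ‖ρ‖ ^ n := div_pow _ _ _
        _ ≤ b ^ n / ‖ρ‖ ^ 2 := by gcongr
        _ ≤ ε / 2 / ‖ρ‖ := by
          rw [div_le_iff₀ hε] at hρb
          rw [div_le_div_iff₀ (by positivity) hρpos]
          nlinarith
    rw [h1, norm_mul, norm_neg, norm_pow, norm_neg]
    calc ‖c‖ ^ n * ‖V.det‖ ≤ ε / 2 / ‖ρ‖ * ‖V.det‖ := by gcongr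
      _ = ε * ‖V.det‖ / 2 / ‖ρ‖ := by ring
  have hBV : ‖B.det - V.det‖ ≤ ε * ‖V.det‖ / ‖ρ‖ := by
    calc ‖B.det - V.det‖ ≤ ‖B.det - A.det‖ + ‖A.det - V.det‖ := norm_sub_le_norm_sub_add_norm_sub ..
      _ ≤ K * (δ / ‖ρ‖) + ε * ‖V.det‖ / 2 / ‖ρ‖ := add_le_add hBA hAV
      _ = (K * δ + ε * ‖V.det‖ / 2) / ‖ρ‖ := by ring
      _ ≤ ε * ‖V.det‖ / ‖ρ‖ := by
        gcongr
        linarith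
  rw [hYdet, ← mul_sub, norm_mul, norm_mul]
  calc ‖ρ ^ (n * (n - 1) / 2)‖ * ‖B.det - V.det‖
      ≤ ‖ρ ^ (n * (n - 1) / 2)‖ * (ε * ‖V.det‖ / ‖ρ‖) := by gcongr
    _ = ε * (‖ρ ^ (n * (n - 1) / 2)‖ * ‖V.det‖) / ‖ρ‖ := by ring
end

section
/- Let n ≥ 3 and suppose p_{n−2} is absolutely continuous on [α,T] with p_{n−2}' ∈ L¹(α,T). Then there exist ρ_* > 0 and, for ρ ∈ S̄ with |ρ| ≥ ρ_*, a fundamental system of solutions {y_k(x,ρ)}_{k=1,…,n} of the equation y^{(n)} + Σ_{m=0}^{n−2} p_m(x) y^{(m)} = ρ^n y such that, uniformly in x ∈ [α,T] as |ρ| → ∞, ρ ∈ S̄, y_k^{(ν)}(x,ρ) = (ρR_k)^ν exp(ρR_k x)(1 + β_1(x)/(ρR_k) + (β_2(x) + ν β_1'(x))/(ρR_k)² + o(1/ρ²)) for ν = 0,…,n−1, where β_1(x) = −(1/n)∫_α^x p_{n−2}(t) dt and β_2(x) = −(1/n)∫_α^x (p_{n−3}(t) + p_{n−2}(t)β_1(t))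 dt − ((n−1)/2)·β_1'(x). -/
open MeasureTheory Set Finset

/-- `β₁(x) = −(1/n)∫_α^x q(t) dt`, with `q = p_{n−2}`. -/
noncomputable def beta1 (n : ℕ) (α : ℝ) (q : ℝ → ℂ) (x : ℝ) : ℂ :=
  -(1 / (n : ℂ)) * ∫ t in α..x, q t

/-- `β₂(x) = −(1/n)∫_α^x (q₃(t) + q₂(t)β₁(t)) dt − ((n−1)/2)·β₁'(x)`, with `q₂ = p_{n−2}`,
`q₃ = p_{n−3}`, and `β₁'(x) = −q₂(x)/n`. -/
noncomputable def beta2 (n : ℕ) (α : ℝ) (q3 q2 : ℝ → ℂ) (x : ℝ) : ℂ :=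
  -(1 / (n : ℂ)) * (∫ t in α..x, (q3 t + q2 t * beta1 n α q2 t)) -
    (((n : ℂ) - 1) / 2) * (-(q2 x) / (n : ℂ))

lemma absolutelyContinuousOnInterval_const {c : ℂ} {a b : ℝ} :
    AbsolutelyContinuousOnInterval (fun _ : ℝ => c) a b :=
  (contDiff_const.contDiffOn : ContDiffOn ℝ 1 _ _).absolutelyContinuousOnInterval

/-- The primitive of a complex-valued integrable function is absolutely continuous. -/
lemma absolutelyContinuousOnInterval_primitive {f : ℝ → ℂ} {a b : ℝ}
    (hf : IntervalIntegrable f volume a b) :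
    AbsolutelyContinuousOnInterval (fun x => ∫ t in a..x, f t) a b := by
  have hre : IntervalIntegrable (fun t => (f t).re) volume a b :=
    ⟨hf.1.re, hf.2.re⟩
  have him : IntervalIntegrable (fun t => (f t).im) volume a b :=
    ⟨hf.1.im, hf.2.im⟩
  have h := ((hre.absolutelyContinuousOnInterval_intervalIntegral left_mem_uIcc).smul
      (absolutelyContinuousOnInterval_const (c := 1))).add
    ((him.absolutelyContinuousOnInterval_intervalIntegral left_mem_uIcc).smul
      (absolutelyContinuousOnInterval_const (c := Complex.I)))
  rw [absolutelyContinuousOnInterval_iff] at h ⊢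
  have key : ∀ x ∈ uIcc a b, (∫ t in a..x, f t) = (∫ t in a..x, (f t).re) • (1 : ℂ) +
      (∫ t in a..x, (f t).im) • Complex.I := by
    intro x hx
    have hs : uIcc a x ⊆ uIcc a b := uIcc_subset_uIcc_left hx
    rw [← intervalIntegral.integral_smul_const, ← intervalIntegral.integral_smul_const,
      ← intervalIntegral.integral_add]
    · refine intervalIntegral.integral_congr fun t _ => ?_
      simp [Complex.re_add_im]
    · have h1 : IntervalIntegrable (fun t => ((f t).re : ℂ)) volume a x :=
        ⟨(hre.mono_set hs).1.ofReal, (hre.mono_set hs).2.ofReal⟩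
      convert h1 using 2
      simp
    · have h1 : IntervalIntegrable (fun t => ((f t).im : ℂ)) volume a x :=
        ⟨(him.mono_set hs).1.ofReal, (him.mono_set hs).2.ofReal⟩
      convert h1.mul_const Complex.I using 2
      simp
  intro ε hε
  obtain ⟨δ, hδ, H⟩ := h ε hε
  refine ⟨δ, hδ, fun E hE hl => ?_⟩
  refine lt_of_eq_of_lt (Finset.sum_congr rfl fun i hi => ?_) (H E hE hl)
  have hI := hE.1 i hi
  rw [key _ hI.1, key _ hI.2]
  rfl

lemma integral_deriv_mul_add_mul {E E' F f : ℝ → ℂ} {a b : ℝ}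
    (hE : ∀ x, HasDerivAt E (E' x) x) (hE' : Continuous E')
    (hf : IntervalIntegrable f volume a b)
    (hF : ∀ x ∈ uIcc a b, F x = F a + ∫ t in a..x, f t) :
    ∫ t in a..b, (E' t * F t + E t * f t) = E b * F b - E a * F a := by
  set G : ℝ → ℂ := fun x => F a + ∫ t in a..x, f t with hG
  have hEc : Continuous E := continuous_iff_continuousAt.2 fun x => (hE x).continuousAt
  have hGac : AbsolutelyContinuousOnInterval G a b :=
    absolutelyContinuousOnInterval_const.add (absolutelyContinuousOnInterval_primitive hf)
  have hEac : AbsolutelyContinuousOnInterval E a b := by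
    refine ContDiffOn.absolutelyContinuousOnInterval (ContDiff.contDiffOn ?_)
    rw [contDiff_one_iff_deriv]
    refine ⟨fun x => (hE x).differentiableAt, ?_⟩
    rwa [funext fun x => (hE x).deriv]
  have hint : IntervalIntegrable (fun t => E' t * G t + E t * f t) volume a b :=
    ((hE'.continuousOn.mul hGac.continuousOn).intervalIntegrable).add
      (hf.continuousOn_mul hEc.continuousOn)
  have hac := (hEac.smul hGac).sub (absolutelyContinuousOnInterval_primitive hint)
  obtain ⟨C, hC⟩ := hac.const_of_ae_hasDerivAt_zero (by
    filter_upwards [hf.ae_hasDerivAt_integral, hint.ae_hasDerivAt_integral] with x h1 h2 hx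
    have d1 := (hE x).mul ((h1 hx a left_mem_uIcc).const_add (F a))
    have d := d1.sub (h2 hx a left_mem_uIcc)
    convert! d using 1
    simp [hG])
  have ha := hC a left_mem_uIcc
  have hb := hC b right_mem_uIcc
  simp only [Pi.sub_apply, smul_eq_mul, Pi.mul_apply, hG,
    intervalIntegral.integral_same, add_zero, sub_zero] at ha hb
  rw [hF b right_mem_uIcc]
  have hcongr : ∫ t in a..b, (E' t * F t + E t * f t) = ∫ t in a..b, (E' t * G t + E t * f t) :=
    intervalIntegral.integral_congr fun t ht => by simp only [hG, hF t ht]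
  rw [hcongr]
  linear_combination ha - hb

/-- Variation of constants for `u' = s u + h` in integrated form. -/
lemma variation_of_constants {h : ℝ → ℂ} {a b c x y : ℝ} (s C : ℂ)
    (hh : IntervalIntegrable h volume a b) (hc : c ∈ uIcc a b) (hx : x ∈ uIcc a b)
    (hy : y ∈ uIcc a b) {u : ℝ → ℂ}
    (hu : ∀ t ∈ uIcc a b, u t = Complex.exp (s * t) *
      (C + ∫ τ in c..t, Complex.exp (-(s * τ)) * h τ)) :
    u x - u y = ∫ t in y..x, (s * u t + h t) := by
  have hsub : uIcc y x ⊆ uIcc a b := uIcc_subset_uIcc hy hx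
  have hk : IntervalIntegrable (fun τ : ℝ => Complex.exp (-(s * τ)) * h τ) volume a b :=
    hh.continuousOn_mul (by fun_prop)
  have hd : ∀ t : ℝ, HasDerivAt (fun t : ℝ => Complex.exp (s * t)) (s * Complex.exp (s * t)) t := by
    intro t
    have := (((hasDerivAt_id t).ofReal_comp).const_mul s).cexp
    simpa [mul_comm] using this
  have := integral_deriv_mul_add_mul (a := y) (b := x)
    (F := fun t => C + ∫ τ in c..t, Complex.exp (-(s * τ)) * h τ) hd (by fun_prop)
    (hk.mono_set hsub) (by
      intro t ht
      rw [add_assoc, intervalIntegral.integral_add_adjacent_intervals]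
      · exact hk.mono_set (uIcc_subset_uIcc hc hy)
      · exact hk.mono_set (uIcc_subset_uIcc hy (hsub ht)))
  rw [hu x hx, hu y hy, ← this]
  refine intervalIntegral.integral_congr fun t ht => ?_
  simp only [hu t (hsub ht)]
  rw [← mul_assoc (Complex.exp _) (Complex.exp _), ← Complex.exp_add]
  simp
  ring

lemma mul_integral_exp_mul_eq {P q : ℝ → ℂ} {c x : ℝ} (μ : ℂ)
    (hq : IntervalIntegrable q volume c x)
    (hP : ∀ t ∈ uIcc c x, P t = P c + ∫ τ in c..t, q τ) :
    μ * ∫ t in c..x, Complex.exp (μ * (x - t)) * P t =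
      (∫ t in c..x, Complex.exp (μ * (x - t)) * q t) - P x +
        Complex.exp (μ * (x - c)) * P c := by
  have hd : ∀ t : ℝ, HasDerivAt (fun t : ℝ => Complex.exp (μ * (x - t)))
      (-μ * Complex.exp (μ * (x - t))) t := by
    intro t
    have := ((((hasDerivAt_id t).ofReal_comp).const_sub (x : ℂ)).const_mul μ).cexp
    simpa [mul_comm] using this
  have hPc : ContinuousOn P (uIcc c x) := by
    refine ContinuousOn.congr ?_ hP
    exact continuousOn_const.add
      (absolutelyContinuousOnInterval_primitive hq).continuousOn
  have := integral_deriv_mul_add_mul hd (by fun_prop) hq hP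
  rw [intervalIntegral.integral_add] at this
  · simp only [mul_assoc, intervalIntegral.integral_const_mul] at this
    simp at this
    linear_combination -this
  · exact (ContinuousOn.mul (by fun_prop) hPc).intervalIntegrable
  · exact hq.continuousOn_mul (by fun_prop)

lemma norm_exp_mul_sub_le_one {μ : ℂ} {c x t : ℝ} (hμ : μ.re * (x - c) ≤ 0)
    (ht : t ∈ uIcc c x) : ‖Complex.exp (μ * (x - t))‖ ≤ 1 := by
  rw [Complex.norm_exp, Real.exp_le_one_iff]
  have : (μ * (x - t)).re = μ.re * (x - t) := by
    rw [← Complex.ofReal_sub, Complex.re_mul_ofReal]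
  rw [this]
  rcases mem_uIcc.1 ht with ⟨h1, h2⟩ | ⟨h1, h2⟩ <;> rcases le_total μ.re 0 with h | h <;> nlinarith

lemma norm_integral_exp_mul_le {h : ℝ → ℂ} {Q : ℝ → ℝ} {μ : ℂ} {a b c x : ℝ} (hab : a ≤ b)
    (hc : c ∈ Icc a b) (hx : x ∈ Icc a b) (hμ : μ.re * (x - c) ≤ 0)
    (hQ : IntervalIntegrable Q volume a b) (hh : ∀ t ∈ Icc a b, ‖h t‖ ≤ Q t) :
    ‖∫ t in c..x, Complex.exp (μ * (x - t)) * h t‖ ≤ ∫ t in a..b, Q t := by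
  have hsub : uIoc c x ⊆ Ioc a b := by
    intro t ht
    rw [uIoc, Set.mem_Ioc] at ht
    exact ⟨lt_of_le_of_lt (le_min hc.1 hx.1) ht.1, ht.2.trans (max_le hc.2 hx.2)⟩
  have hQi : IntegrableOn Q (Ioc a b) volume := by
    rwa [intervalIntegrable_iff_integrableOn_Ioc_of_le hab] at hQ
  rw [intervalIntegral.integral_of_le hab]
  refine (intervalIntegral.norm_integral_le_integral_norm_uIoc).trans ?_
  refine (integral_mono_of_nonneg (Filter.Eventually.of_forall fun _ => norm_nonneg _)
    (hQi.mono_set hsub) ?_).trans (setIntegral_mono_set hQi ?_ hsub.eventuallyLE)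
  · refine (ae_restrict_iff' measurableSet_uIoc).2 (Filter.Eventually.of_forall fun t ht => ?_)
    simp only [norm_mul]
    have h1 := norm_exp_mul_sub_le_one hμ (uIoc_subset_uIcc ht)
    have h2 := hh t (Ioc_subset_Icc_self (hsub ht))
    nlinarith [norm_nonneg (h t)]
  · exact (ae_restrict_iff' measurableSet_Ioc).2 (Filter.Eventually.of_forall fun t ht =>
      (norm_nonneg _).trans (hh t (Ioc_subset_Icc_self ht)))

/-- A Riemann–Lebesgue lemma, uniform over complex frequencies for which the kernel stays
bounded. -/
lemma riemann_lebesgue_exp {f : ℝ → ℂ} {a b : ℝ} (hab : a ≤ b)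
    (hf : IntervalIntegrable f volume a b) {ε : ℝ} (hε : 0 < ε) :
    ∃ M : ℝ, ∀ μ : ℂ, M ≤ ‖μ‖ → ∀ c ∈ Icc a b, ∀ x ∈ Icc a b, μ.re * (x - c) ≤ 0 →
      ‖∫ t in c..x, Complex.exp (μ * (x - t)) * f t‖ ≤ ε := by
  have hfi : IntegrableOn f (Ioc a b) volume := by
    rwa [intervalIntegrable_iff_integrableOn_Ioc_of_le hab] at hf
  have hmem : MemLp ((Ioc a b).indicator f) 1 volume :=
    memLp_one_iff_integrable.2 ((integrable_indicator_iff measurableSet_Ioc).2 hfi)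
  obtain ⟨g, hgs, hg, hfg⟩ := hmem.exist_eLpNorm_sub_le ENNReal.one_ne_top le_rfl (half_pos hε)
  have hgc : Continuous g := hg.continuous
  have hg' : Continuous (deriv g) := hg.continuous_deriv (by simp)
  have hgd : ∀ t, HasDerivAt g (deriv g t) t := fun t =>
    ((hg.differentiable (by simp)) t).hasDerivAt
  have hgi : IntervalIntegrable g volume a b := hgc.intervalIntegrable _ _
  have hclose : ∫ t in a..b, ‖f t - g t‖ ≤ ε / 2 := by
    have h1 : ∫ t in a..b, ‖f t - g t‖ = ∫ t in Ioc a b, ‖((Ioc a b).indicator f - g) t‖ := by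
      rw [intervalIntegral.integral_of_le hab]
      refine setIntegral_congr_fun measurableSet_Ioc fun t ht => ?_
      simp [ht]
    have hint : Integrable ((Ioc a b).indicator f - g) volume :=
      (memLp_one_iff_integrable.1 hmem).sub (hgc.integrable_of_hasCompactSupport hgs)
    rw [h1]
    refine (setIntegral_le_integral hint.norm
      (Filter.Eventually.of_forall fun _ => norm_nonneg _)).trans ?_
    rw [integral_norm_eq_lintegral_enorm hint.1, ← eLpNorm_one_eq_lintegral_enorm]
    exact ENNReal.toReal_le_of_le_ofReal (half_pos hε).le hfg
  obtain ⟨K, hK⟩ := isCompact_Icc.exists_bound_of_continuousOn (s := Icc a b) hgc.continuousOn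
  set D := ∫ t in a..b, ‖deriv g t‖ with hD
  refine ⟨max 1 ((D + 2 * K) / (ε / 2)), fun μ hM c hc x hx hμ => ?_⟩
  have hsub : uIcc c x ⊆ uIcc a b := by rw [uIcc_of_le hab]; exact uIcc_subset_Icc hc hx
  have hpos : 0 < ‖μ‖ := lt_of_lt_of_le one_pos ((le_max_left _ _).trans hM)
  have hsmooth : ‖∫ t in c..x, Complex.exp (μ * (x - t)) * g t‖ ≤ ε / 2 := by
    have hmain := mul_integral_exp_mul_eq (P := g) (q := deriv g) (c := c) (x := x) μ
      (hg'.intervalIntegrable _ _) (fun t _ => by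
        rw [intervalIntegral.integral_deriv_eq_sub (fun y _ => (hgd y).differentiableAt)
          (hg'.intervalIntegrable _ _)]; ring)
    have h1 := norm_integral_exp_mul_le (h := deriv g) hab hc hx hμ
      (hg'.norm.intervalIntegrable a b) (fun t _ => le_rfl)
    have h2 : ‖μ‖ * ‖∫ t in c..x, Complex.exp (μ * (x - t)) * g t‖ ≤ D + 2 * K := by
      rw [← norm_mul, hmain]
      refine (norm_add_le _ _).trans ?_
      refine (add_le_add_left (norm_sub_le _ _) _).trans ?_
      rw [norm_mul]
      have h3 := norm_exp_mul_sub_le_one hμ (left_mem_uIcc)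
      have h4 := hK c hc
      have h5 := hK x hx
      nlinarith [norm_nonneg (g c)]
    have h3 : (D + 2 * K) ≤ ‖μ‖ * (ε / 2) := by
      rw [← div_le_iff₀ (half_pos hε)]
      exact (le_max_right _ _).trans hM
    exact le_of_mul_le_mul_left (h2.trans h3) hpos
  have hrough := norm_integral_exp_mul_le (h := fun t => f t - g t) hab hc hx hμ
    (hf.sub hgi).norm (fun t _ => le_rfl)
  have hsplit : ∫ t in c..x, Complex.exp (μ * (x - t)) * f t =
      (∫ t in c..x, Complex.exp (μ * (x - t)) * (f t - g t)) +
        ∫ t in c..x, Complex.exp (μ * (x - t)) * g t := by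
    rw [← intervalIntegral.integral_add]
    · simp [mul_sub]
    · exact ((hf.sub hgi).mono_set hsub).continuousOn_mul (by fun_prop)
    · exact (hgi.mono_set hsub).continuousOn_mul (by fun_prop)
  rw [hsplit]
  refine (norm_add_le _ _).trans ?_
  linarith [hrough.trans hclose]

lemma continuousOn_integral_exp_mul {h : ℝ → ℂ} {a b c : ℝ} (hab : a ≤ b) (hc : c ∈ Icc a b)
    (hh : IntervalIntegrable h volume a b) (μ : ℂ) :
    ContinuousOn (fun x : ℝ => ∫ t in c..x, Complex.exp (μ * (x - t)) * h t) (Icc a b) := by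
  have h1 : ∀ x : ℝ, ∫ t in c..x, Complex.exp (μ * (x - t)) * h t =
      Complex.exp (μ * x) * ∫ t in c..x, Complex.exp (-(μ * t)) * h t := by
    intro x
    rw [← intervalIntegral.integral_const_mul]
    refine intervalIntegral.integral_congr fun t _ => ?_
    rw [← mul_assoc, ← Complex.exp_add]
    ring_nf
  simp only [h1]
  rw [← uIcc_of_le hab] at hc ⊢
  refine ContinuousOn.mul (by fun_prop) ?_
  exact intervalIntegral.continuousOn_primitive_interval'
    (hh.continuousOn_mul (by fun_prop)) hc

/-- Solvability of a system of linear integral equations with bounded exponential kernels, whose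
base points `c j` may differ from one component to the next. -/
lemma exists_integral_system {ι : Type*} [Fintype ι] {a b : ℝ} (hab : a ≤ b)
    {c : ι → ℝ} (hc : ∀ j, c j ∈ Icc a b) {μ : ι → ℂ}
    (hμ : ∀ j, ∀ x ∈ Icc a b, (μ j).re * (x - c j) ≤ 0)
    {A : ι → ι → ℝ → ℂ} (hA : ∀ j l, IntervalIntegrable (A j l) volume a b)
    (hsmall : ∀ j, ∫ t in a..b, ∑ l, ‖A j l t‖ ≤ 1 / 2)
    {g : ι → ℝ → ℂ} (hg : ∀ j, Continuous (g j)) :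
    ∃ w : ι → ℝ → ℂ, (∀ j, Continuous (w j)) ∧
      (∀ j, ∀ x ∈ Icc a b, w j x = g j x +
        ∫ t in (c j)..x, Complex.exp (μ j * (x - t)) * ∑ l, A j l t * w l t) ∧
      ∀ G : ℝ, 0 ≤ G → (∀ j, ∀ x ∈ Icc a b, ‖g j x‖ ≤ G) →
        ∀ j, ∀ x ∈ Icc a b, ‖w j x‖ ≤ 2 * G := by
  set e : C(Icc a b, ι → ℂ) → ι → ℝ → ℂ := fun v l t => v (projIcc a b hab t) l with he
  have hec : ∀ v l, Continuous (e v l) := fun v l =>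
    (continuous_apply l).comp (v.continuous.comp continuous_projIcc)
  have hint : ∀ v j, IntervalIntegrable (fun t => ∑ l, A j l t * e v l t) volume a b := by
    intro v j
    have := IntervalIntegrable.sum Finset.univ (f := fun l t => A j l t * e v l t)
      (μ := volume) (a := a) (b := b) fun l _ => (hA j l).mul_continuousOn (hec v l).continuousOn
    simpa only [Finset.sum_fn] using this
  have hQ : ∀ (d : ℝ) j, IntervalIntegrable (fun t => (∑ l, ‖A j l t‖) * d) volume a b := by
    intro d j
    have := IntervalIntegrable.sum Finset.univ (f := fun l t => ‖A j l t‖)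
      (μ := volume) (a := a) (b := b) fun l _ => (hA j l).norm
    simp only [Finset.sum_fn] at this
    exact this.mul_const d
  let Φ : C(Icc a b, ι → ℂ) → C(Icc a b, ι → ℂ) := fun v =>
    { toFun := fun x j => g j x +
        ∫ t in (c j)..(x : ℝ), Complex.exp (μ j * ((x : ℝ) - t)) * ∑ l, A j l t * e v l t
      continuous_toFun := by
        refine continuous_pi fun j => ((hg j).comp continuous_subtype_val).add ?_
        exact continuousOn_iff_continuous_domRestrict.1
          (continuousOn_integral_exp_mul hab (hc j) (hint v j) (μ j)) }
  have hbound : ∀ v j (d : ℝ), 0 ≤ d → (∀ l t, ‖e v l t‖ ≤ d) → ∀ x ∈ Icc a b,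
      ‖∫ t in (c j)..x, Complex.exp (μ j * (x - t)) * ∑ l, A j l t * e v l t‖ ≤ d / 2 := by
    intro v j d hd hv x hx
    refine (norm_integral_exp_mul_le hab (hc j) hx (hμ j x hx) (hQ d j) fun t _ => ?_).trans ?_
    · rw [Finset.sum_mul]
      refine (norm_sum_le _ _).trans (Finset.sum_le_sum fun l _ => ?_)
      rw [norm_mul]
      exact mul_le_mul_of_nonneg_left (hv l t) (norm_nonneg _)
    · rw [intervalIntegral.integral_mul_const]
      nlinarith [hsmall j]
  have hΦ : ContractingWith (1 / 2) Φ := by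
    refine ⟨by norm_num, LipschitzWith.of_dist_le_mul fun v v' => ?_⟩
    have hd : (0 : ℝ) ≤ dist v v' := dist_nonneg
    rw [ContinuousMap.dist_le (by positivity)]
    intro x
    rw [dist_pi_le_iff (by positivity)]
    intro j
    have h1 : Φ v x j - Φ v' x j = ∫ t in (c j)..(x : ℝ),
        Complex.exp (μ j * ((x : ℝ) - t)) * ∑ l, A j l t * e (v - v') l t := by
      have hs : uIcc (c j) x ⊆ uIcc a b := by
        rw [uIcc_of_le hab]; exact uIcc_subset_Icc (hc j) x.2
      simp only [Φ, ContinuousMap.coe_mk, add_sub_add_left_eq_sub]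
      rw [← intervalIntegral.integral_sub]
      · refine intervalIntegral.integral_congr fun t _ => ?_
        simp only [he, ContinuousMap.sub_apply, Pi.sub_apply, mul_sub, Finset.sum_sub_distrib]
      · exact ((hint v j).mono_set hs).continuousOn_mul (by fun_prop)
      · exact ((hint v' j).mono_set hs).continuousOn_mul (by fun_prop)
    rw [dist_eq_norm, h1]
    refine (hbound (v - v') j (dist v v') hd (fun l t => ?_) x x.2).trans ?_
    · rw [dist_eq_norm]
      exact (norm_le_pi_norm _ l).trans ((v - v').norm_coe_le_norm _)
    · simp; linarith
  set v := hΦ.fixedPoint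
  have hv : Φ v = v := hΦ.fixedPoint_isFixedPt
  have hvx : ∀ j, ∀ x ∈ Icc a b, e v j x = g j x +
      ∫ t in (c j)..x, Complex.exp (μ j * (x - t)) * ∑ l, A j l t * e v l t := by
    intro j x hx
    have h1 : e v j x = Φ v ⟨x, hx⟩ j := by
      rw [hv]; simp only [he]; rw [projIcc_of_mem hab hx]
    rw [h1]; rfl
  refine ⟨e v, hec v, hvx, fun G hG hgG => ?_⟩
  have hle : ∀ l t, ‖e v l t‖ ≤ ‖v‖ := fun l t =>
    (norm_le_pi_norm _ l).trans (v.norm_coe_le_norm _)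
  have hnorm : ‖v‖ ≤ G + ‖v‖ / 2 := by
    rw [ContinuousMap.norm_le _ (by positivity)]
    intro x
    rw [pi_norm_le_iff_of_nonneg (by positivity)]
    intro j
    have h1 : v x j = e v j x := by simp [he]
    rw [h1, hvx j x x.2]
    exact (norm_add_le _ _).trans
      (add_le_add (hgG j x x.2) (hbound v j _ (norm_nonneg v) hle x x.2))
  intro j x _
  linarith [hle j x]

section RootsOfUnity

variable {n : ℕ} {r : Fin n → ℂ}

lemma sum_comp_eq_sum_nthRootsFinset (hn : 0 < n) (hinj : Function.Injective r)
    (hr : ∀ j, r j ^ n = 1) (F : ℂ → ℂ) :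
    ∑ j, F (r j) = ∑ x ∈ Polynomial.nthRootsFinset n (1 : ℂ), F x := by
  have hcard := (Complex.isPrimitiveRoot_exp n hn.ne').card_nthRootsFinset
  have himage : Finset.univ.image r = Polynomial.nthRootsFinset n (1 : ℂ) := by
    refine Finset.eq_of_subset_of_card_le (fun x hx => ?_) ?_
    · obtain ⟨j, -, rfl⟩ := Finset.mem_image.1 hx
      exact (Polynomial.mem_nthRootsFinset hn _).2 (hr j)
    · rw [hcard, Finset.card_image_of_injective _ hinj, Finset.card_univ, Fintype.card_fin]
  rw [← himage, Finset.sum_image fun _ _ _ _ h => hinj h]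

lemma sum_pow_roots_eq_zero (hn : 0 < n) (hinj : Function.Injective r)
    (hr : ∀ j, r j ^ n = 1) {m : ℕ} (hm : 0 < m) (hmn : m < n) : ∑ j, r j ^ m = 0 := by
  rw [sum_comp_eq_sum_nthRootsFinset hn hinj hr fun x => x ^ m]
  have hζ := Complex.isPrimitiveRoot_exp n hn.ne'
  set ζ := Complex.exp (2 * Real.pi * Complex.I / n)
  have hζ0 : ζ ≠ 0 := Complex.exp_ne_zero _
  have hmul : ∑ x ∈ Polynomial.nthRootsFinset n (1 : ℂ), x ^ m =
      ∑ x ∈ Polynomial.nthRootsFinset n (1 : ℂ), (ζ * x) ^ m := by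
    refine Finset.sum_nbij' (fun x => ζ⁻¹ * x) (fun x => ζ * x) ?_ ?_ ?_ ?_ ?_
    · intro x hx
      rw [Polynomial.mem_nthRootsFinset hn] at hx ⊢
      rw [mul_pow, hx, inv_pow, hζ.pow_eq_one]; simp
    · intro x hx
      rw [Polynomial.mem_nthRootsFinset hn] at hx ⊢
      rw [mul_pow, hx, hζ.pow_eq_one]; simp
    · intro x _; field_simp
    · intro x _; field_simp
    · intro x _; field_simp
  simp only [mul_pow, ← Finset.mul_sum] at hmul
  have hne : ζ ^ m ≠ 1 := hζ.pow_ne_one_of_pos_of_lt hm.ne' hmn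
  have : (ζ ^ m - 1) * ∑ x ∈ Polynomial.nthRootsFinset n (1 : ℂ), x ^ m = 0 := by
    linear_combination -hmul
  exact (mul_eq_zero.1 this).resolve_left (sub_ne_zero.2 hne)

/-- The term with `r j = 1` contributes `0` because of division by zero. -/
lemma sum_pow_div_sub_one (hn : 0 < n) (hinj : Function.Injective r)
    (hr : ∀ j, r j ^ n = 1) {k : Fin n} (hk : r k = 1) {ν : ℕ} (hν : ν < n) :
    ∑ j, r j ^ (ν + 1) / (r j - 1) = ((n : ℂ) - 1) / 2 - ν := by
  have hne : ∀ j, j ≠ k → r j - 1 ≠ 0 := fun j hj h =>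
    hj (hinj (by rw [hk]; exact sub_eq_zero.1 h))
  have hind : ∑ j, (if j = k then (0 : ℂ) else 1) = n - 1 := by
    have h1 : ∀ j : Fin n, (if j = k then (0 : ℂ) else 1) = 1 - if j = k then 1 else 0 := by
      intro j; split_ifs <;> simp
    simp [h1]
  induction ν with
  | zero =>
    have hinv : ∑ j, r j / (r j - 1) = ∑ j, (r j)⁻¹ / ((r j)⁻¹ - 1) := by
      rw [sum_comp_eq_sum_nthRootsFinset hn hinj hr fun x => x / (x - 1),
        sum_comp_eq_sum_nthRootsFinset hn hinj hr fun x => x⁻¹ / (x⁻¹ - 1)]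
      refine Finset.sum_nbij' (fun x => x⁻¹) (fun x => x⁻¹) ?_ ?_ ?_ ?_ ?_
      · intro x hx
        rw [Polynomial.mem_nthRootsFinset hn] at hx ⊢
        rw [inv_pow, hx, inv_one]
      · intro x hx
        rw [Polynomial.mem_nthRootsFinset hn] at hx ⊢
        rw [inv_pow, hx, inv_one]
      all_goals intro x _; simp
    have hadd : ∑ j, r j / (r j - 1) + ∑ j, (r j)⁻¹ / ((r j)⁻¹ - 1) = n - 1 := by
      rw [← Finset.sum_add_distrib, ← hind]
      refine Finset.sum_congr rfl fun j _ => ?_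
      split_ifs with hj
      · simp [hj, hk]
      · have h0 : r j ≠ 0 := fun h => by
          have := hr j
          rw [h, zero_pow hn.ne'] at this
          exact zero_ne_one this
        have h1 := hne j hj
        have h2 : (r j)⁻¹ - 1 ≠ 0 := by
          intro h
          apply h1
          have := sub_eq_zero.1 h
          rw [inv_eq_one] at this
          rw [this, sub_self]
        rw [div_add_div _ _ h1 h2, div_eq_one_iff_eq (mul_ne_zero h1 h2)]
        field_simp
        ring
    simp only [zero_add, pow_one, Nat.cast_zero, sub_zero]
    linear_combination (hadd + hinv) / 2
  | succ ν ih =>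
    have hstep : ∑ j, r j ^ (ν + 1 + 1) / (r j - 1) - ∑ j, r j ^ (ν + 1) / (r j - 1) =
        ∑ j, r j ^ (ν + 1) - 1 := by
      have h1 : ∑ j, (if j = k then (1 : ℂ) else 0) = 1 := by simp
      rw [← Finset.sum_sub_distrib]
      conv_rhs => rw [← h1]
      rw [← Finset.sum_sub_distrib]
      refine Finset.sum_congr rfl fun j _ => ?_
      split_ifs with hj
      · simp [hj, hk]
      · have := hne j hj
        field_simp
        ring
    rw [sum_pow_roots_eq_zero hn hinj hr (Nat.succ_pos ν) hν] at hstep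
    push_cast
    linear_combination hstep + ih (by omega)

end RootsOfUnity

/-- Kernel of the first-order system to which the substitution
`y^{(ν)} = λ^ν e^{λx} ∑ j, r j ^ ν * w j` reduces the equation. -/
noncomputable def systemKernel (n : ℕ) (p : Fin (n - 1) → ℝ → ℂ) (r : Fin n → ℂ) (lam : ℂ)
    (j l : Fin n) (t : ℝ) : ℂ :=
  -(r j / n) * ∑ m : Fin (n - 1), p m t * (lam ^ (m : ℕ) / lam ^ (n - 1)) * r l ^ (m : ℕ)

/-- The endpoint of `[a,b]` from which `e^{μ(x - ·)}` is integrated, so that the exponential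
remains bounded. -/
noncomputable def basePoint (a b : ℝ) (μ : ℂ) : ℝ := if μ.re ≤ 0 then a else b

/-- The integral equations for `w`, the free terms being
`δ_{jk} + κ j * e^{μ_j (x - c_j)}` with `μ_j = λ (r j - 1)`. -/
structure IsSystemSolution (n : ℕ) (a b : ℝ) (p : Fin (n - 1) → ℝ → ℂ) (r : Fin n → ℂ)
    (k : Fin n) (lam : ℂ) (κ : Fin n → ℂ) (w : Fin n → ℝ → ℂ) : Prop where
  cont : ∀ j, Continuous (w j)
  eqn : ∀ j, ∀ x ∈ Icc a b, w j x = ((if j = k then 1 else 0) +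
      κ j * Complex.exp (lam * (r j - 1) * (x - basePoint a b (lam * (r j - 1))))) +
      ∫ t in (basePoint a b (lam * (r j - 1)))..x,
        Complex.exp (lam * (r j - 1) * (x - t)) * ∑ l, systemKernel n p r lam j l t * w l t
  bound : ∀ j, ∀ x ∈ Icc a b, ‖w j x‖ ≤ 4

lemma basePoint_mem {a b : ℝ} (hab : a ≤ b) (μ : ℂ) : basePoint a b μ ∈ Icc a b := by
  unfold basePoint
  split_ifs
  · exact left_mem_Icc.2 hab
  · exact right_mem_Icc.2 hab

lemma re_mul_sub_basePoint_nonpos {a b x : ℝ} (hx : x ∈ Icc a b) (μ : ℂ) :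
    μ.re * (x - basePoint a b μ) ≤ 0 := by
  unfold basePoint
  split_ifs with h
  · exact mul_nonpos_of_nonpos_of_nonneg h (sub_nonneg.2 hx.1)
  · exact mul_nonpos_of_nonneg_of_nonpos (not_le.1 h).le (sub_nonpos.2 hx.2)

section System

variable {n : ℕ} {a b : ℝ} {p : Fin (n - 1) → ℝ → ℂ} {r : Fin n → ℂ} {lam : ℂ}

lemma norm_root_eq_one (hn : 0 < n) (hr : ∀ j, r j ^ n = 1) (j : Fin n) : ‖r j‖ = 1 :=
  Complex.norm_eq_one_of_pow_eq_one (hr j) hn.ne'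

lemma norm_root_div_le_one (hn : 0 < n) (hr : ∀ j, r j ^ n = 1) (j : Fin n) :
    ‖r j / n‖ ≤ 1 := by
  rw [norm_div, norm_root_eq_one hn hr, Complex.norm_natCast]
  have : (1 : ℝ) ≤ n := by exact_mod_cast hn
  exact div_le_one_of_le₀ this (by positivity)

lemma norm_pow_div_pow_le (hlam : 1 ≤ ‖lam‖) {m i N : ℕ} (h : m + i ≤ N) :
    ‖lam ^ m / lam ^ N‖ ≤ 1 / ‖lam‖ ^ i := by
  have hpos : 0 < ‖lam‖ := by linarith
  rw [norm_div, norm_pow, norm_pow, div_le_div_iff₀ (by positivity) (by positivity), ← pow_add,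
    one_mul]
  exact pow_le_pow_right₀ hlam h

lemma intervalIntegrable_sum_norm (hp : ∀ m, IntervalIntegrable (p m) volume a b) :
    IntervalIntegrable (fun t => ∑ m, ‖p m t‖) volume a b := by
  simpa only [Finset.sum_fn] using
    IntervalIntegrable.sum Finset.univ (f := fun m t => ‖p m t‖) fun m _ => (hp m).norm

lemma intervalIntegrable_systemKernel (hp : ∀ m, IntervalIntegrable (p m) volume a b)
    (j l : Fin n) : IntervalIntegrable (systemKernel n p r lam j l) volume a b := by
  have := IntervalIntegrable.sum Finset.univ (μ := volume) (a := a) (b := b)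
    (f := fun m : Fin (n - 1) => fun t =>
      p m t * (lam ^ (m : ℕ) / lam ^ (n - 1)) * r l ^ (m : ℕ))
    fun m _ => ((hp m).mul_const _).mul_const _
  simp only [Finset.sum_fn] at this
  exact this.const_mul _

lemma norm_systemKernel_le (hn : 0 < n) (hr : ∀ j, r j ^ n = 1) (hlam : 1 ≤ ‖lam‖)
    (j l : Fin n) (t : ℝ) : ‖systemKernel n p r lam j l t‖ ≤ (∑ m, ‖p m t‖) * (1 / ‖lam‖) := by
  unfold systemKernel
  rw [norm_mul, norm_neg, Finset.sum_mul]
  refine (mul_le_of_le_one_left (norm_nonneg _) (norm_root_div_le_one hn hr j)).trans ?_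
  refine (norm_sum_le _ _).trans (Finset.sum_le_sum fun m _ => ?_)
  rw [norm_mul, norm_mul, norm_pow, norm_root_eq_one hn hr, one_pow, mul_one]
  refine mul_le_mul_of_nonneg_left ?_ (norm_nonneg _)
  simpa using norm_pow_div_pow_le (i := 1) hlam (show (m : ℕ) + 1 ≤ n - 1 by omega)

lemma exists_isSystemSolution (hn : 0 < n) (hab : a ≤ b)
    (hp : ∀ m, IntervalIntegrable (p m) volume a b) (hr : ∀ j, r j ^ n = 1) (k : Fin n)
    (hlam : 1 ≤ ‖lam‖) (hlam' : 2 * n * (∫ t in a..b, ∑ m, ‖p m t‖) ≤ ‖lam‖)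
    {κ : Fin n → ℂ} (hκ : ∀ j, ‖κ j‖ ≤ 1) :
    ∃ w, IsSystemSolution n a b p r k lam κ w := by
  have hpos : 0 < ‖lam‖ := by linarith
  obtain ⟨w, hw, hweq, hwb⟩ := exists_integral_system hab
    (c := fun j => basePoint a b (lam * (r j - 1))) (fun j => basePoint_mem hab _)
    (μ := fun j => lam * (r j - 1)) (fun j x hx => re_mul_sub_basePoint_nonpos hx _)
    (A := systemKernel n p r lam) (intervalIntegrable_systemKernel hp) (fun j => by
      have hQ := ((intervalIntegrable_sum_norm hp).mul_const (1 / ‖lam‖)).const_mul (n : ℝ)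
      have hK : IntervalIntegrable (fun t => ∑ l, ‖systemKernel n p r lam j l t‖) volume a b := by
        simpa only [Finset.sum_fn] using
          IntervalIntegrable.sum Finset.univ (f := fun l t => ‖systemKernel n p r lam j l t‖)
            fun l _ => (intervalIntegrable_systemKernel hp j l).norm
      refine (intervalIntegral.integral_mono_on hab hK hQ fun t _ => ?_).trans ?_
      · refine (Finset.sum_le_sum fun l _ => norm_systemKernel_le hn hr hlam j l t).trans ?_
        simp
      · rw [intervalIntegral.integral_const_mul, intervalIntegral.integral_mul_const,
          ← mul_assoc, mul_one_div, div_le_iff₀ hpos]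
        linarith)
    (g := fun j x => (if j = k then 1 else 0) +
      κ j * Complex.exp (lam * (r j - 1) * (x - basePoint a b (lam * (r j - 1)))))
    (fun j => by fun_prop)
  refine ⟨w, hw, hweq, fun j x hx => ?_⟩
  refine (hwb 2 (by norm_num) (fun j x hx => ?_) j x hx).trans (by norm_num)
  refine (norm_add_le _ _).trans ?_
  rw [norm_mul]
  have h1 := norm_exp_mul_sub_le_one (re_mul_sub_basePoint_nonpos hx (lam * (r j - 1)))
    left_mem_uIcc
  have h2 : ‖(if j = k then (1 : ℂ) else 0)‖ ≤ 1 := by split_ifs <;> simp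
  nlinarith [hκ j, norm_nonneg (κ j), norm_nonneg (Complex.exp (lam * (r j - 1) *
    (x - basePoint a b (lam * (r j - 1)))))]

variable {k : Fin n} {κ : Fin n → ℂ} {w : Fin n → ℝ → ℂ}

lemma intervalIntegrable_systemKernel_mul (hp : ∀ m, IntervalIntegrable (p m) volume a b)
    (hw : ∀ j, Continuous (w j)) (j : Fin n) :
    IntervalIntegrable (fun t => ∑ l, systemKernel n p r lam j l t * w l t) volume a b := by
  simpa only [Finset.sum_fn] using
    IntervalIntegrable.sum Finset.univ (f := fun l t => systemKernel n p r lam j l t * w l t)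
      fun l _ => (intervalIntegrable_systemKernel hp j l).mul_continuousOn (hw l).continuousOn

/-- First approximation of the solutions of the integral system. -/
lemma IsSystemSolution.norm_sub_le (hw : IsSystemSolution n a b p r k lam κ w) (hn : 0 < n)
    (hab : a ≤ b) (hp : ∀ m, IntervalIntegrable (p m) volume a b) (hr : ∀ j, r j ^ n = 1)
    (hlam : 1 ≤ ‖lam‖) (j : Fin n) {x : ℝ} (hx : x ∈ Icc a b) :
    ‖w j x - if j = k then 1 else 0‖ ≤
      ‖κ j‖ + 4 * n * (∫ t in a..b, ∑ m, ‖p m t‖) / ‖lam‖ := by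
  rw [hw.eqn j x hx, add_assoc, add_sub_cancel_left]
  refine (norm_add_le _ _).trans (add_le_add ?_ ?_)
  · rw [norm_mul]
    exact mul_le_of_le_one_right (norm_nonneg _)
      (norm_exp_mul_sub_le_one (re_mul_sub_basePoint_nonpos hx (lam * (r j - 1))) left_mem_uIcc)
  · have h := norm_integral_exp_mul_le (μ := lam * (r j - 1))
      (h := fun t => ∑ l, systemKernel n p r lam j l t * w l t) hab
      (basePoint_mem hab _) hx (re_mul_sub_basePoint_nonpos hx _)
      ((intervalIntegrable_sum_norm hp).mul_const (4 * n / ‖lam‖)) (fun t ht => by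
        refine (norm_sum_le _ _).trans ((Finset.sum_le_sum (g := fun _ =>
          (∑ m, ‖p m t‖) * (1 / ‖lam‖) * 4) fun l _ => ?_).trans (le_of_eq ?_))
        · rw [norm_mul]
          exact mul_le_mul (norm_systemKernel_le hn hr hlam j l t) (hw.bound l t ht)
            (norm_nonneg _) (by positivity)
        · simp; ring)
    rw [intervalIntegral.integral_mul_const] at h
    refine h.trans (le_of_eq (by ring))

end System

section SecondOrder

variable {n : ℕ} {a b : ℝ} {p : Fin (n - 1) → ℝ → ℂ} {r : Fin n → ℂ} {lam : ℂ} {k : Fin n}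

lemma norm_integral_exp_mul_sub_le {F G : ℝ → ℂ} {Q : ℝ → ℝ} {μ : ℂ} {a b c x δ : ℝ} (hab : a ≤ b)
    (hc : c ∈ Icc a b) (hx : x ∈ Icc a b) (hμ : μ.re * (x - c) ≤ 0)
    (hF : IntervalIntegrable F volume a b) (hG : IntervalIntegrable G volume a b)
    (hQ : IntervalIntegrable Q volume a b) (hFG : ∀ t ∈ Icc a b, ‖F t - G t‖ ≤ Q t * δ) :
    ‖(∫ t in c..x, Complex.exp (μ * (x - t)) * F t) -
      ∫ t in c..x, Complex.exp (μ * (x - t)) * G t‖ ≤ (∫ t in a..b, Q t) * δ := by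
  have hs : uIcc c x ⊆ uIcc a b := by
    rw [uIcc_of_le hab]; exact uIcc_subset_Icc hc hx
  rw [← intervalIntegral.integral_sub ((hF.mono_set hs).continuousOn_mul (by fun_prop))
    ((hG.mono_set hs).continuousOn_mul (by fun_prop)), ← intervalIntegral.integral_mul_const]
  simp only [← mul_sub]
  exact norm_integral_exp_mul_le hab hc hx hμ (hQ.mul_const δ) hFG

lemma sum_systemKernel_mul (j : Fin n) (w : Fin n → ℂ) (t : ℝ) :
    ∑ l, systemKernel n p r lam j l t * w l =
      -(r j / n) * ∑ m, p m t * (lam ^ (m : ℕ) / lam ^ (n - 1) * ∑ l, r l ^ (m : ℕ) * w l) := by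
  simp only [systemKernel, mul_assoc, Finset.sum_mul, ← Finset.mul_sum]
  rw [Finset.sum_comm]
  simp only [Finset.mul_sum]

lemma norm_sum_systemKernel_mul_add_le (hn : 0 < n) (hr : ∀ j, r j ^ n = 1) (j : Fin n)
    {w : Fin n → ℂ} {t δ : ℝ} {θ : Fin (n - 1) → ℂ}
    (hθ : ∀ m : Fin (n - 1),
      ‖lam ^ (m : ℕ) / lam ^ (n - 1) * (∑ l, r l ^ (m : ℕ) * w l) - θ m‖ ≤ δ) :
    ‖∑ l, systemKernel n p r lam j l t * w l - -(r j / n) * ∑ m, p m t * θ m‖ ≤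
      (∑ m, ‖p m t‖) * δ := by
  rw [sum_systemKernel_mul, ← mul_sub, ← Finset.sum_sub_distrib, norm_mul, norm_neg,
    Finset.sum_mul]
  refine (mul_le_of_le_one_left (norm_nonneg _) (norm_root_div_le_one hn hr j)).trans ?_
  refine (norm_sum_le _ _).trans (Finset.sum_le_sum fun m _ => ?_)
  rw [← mul_sub, norm_mul]
  exact mul_le_mul_of_nonneg_left (hθ m) (norm_nonneg _)

lemma norm_sum_pow_mul_sub_le (hn : 0 < n) (hr : ∀ j, r j ^ n = 1) (m : ℕ)
    {w : Fin n → ℂ} {z : Fin n → ℂ} {δ : ℝ} (hw : ∀ l, ‖w l - z l‖ ≤ δ) :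
    ‖∑ l, r l ^ m * w l - ∑ l, r l ^ m * z l‖ ≤ n * δ := by
  rw [← Finset.sum_sub_distrib]
  refine (norm_sum_le _ _).trans ((Finset.sum_le_sum (g := fun _ => δ) fun l _ => ?_).trans ?_)
  · rw [← mul_sub, norm_mul, norm_pow, norm_root_eq_one hn hr, one_pow, one_mul]
    exact hw l
  · simp

lemma sum_root_pow_mul_ite (hk : r k = 1) (m : ℕ) (z : ℂ) :
    ∑ l, r l ^ m * (if l = k then z else 0) = z := by
  simp [hk]

lemma exp_integral_self (hk : r k = 1) (F : ℝ → ℂ) (x : ℝ) :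
    ∫ t in (basePoint a b (lam * (r k - 1)))..x, Complex.exp (lam * (r k - 1) * (x - t)) * F t =
      ∫ t in a..x, F t := by
  simp [hk, basePoint]

end SecondOrder

/-- The initial constants which cancel the boundary terms of the second-order expansion. -/
noncomputable def boundaryConst (n : ℕ) (a b : ℝ) (P : ℝ → ℂ) (r : Fin n → ℂ) (lam : ℂ)
    (j : Fin n) : ℂ :=
  r j * P (basePoint a b (lam * (r j - 1))) / (n * lam * (lam * (r j - 1)))

lemma exists_norm_boundaryConst_le {n : ℕ} {a b : ℝ} {r : Fin n → ℂ} (hn : 0 < n)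
    (hr : ∀ j, r j ^ n = 1) (P : ℝ → ℂ) :
    ∃ K : ℝ, 0 ≤ K ∧ ∀ lam : ℂ, ∀ j, ‖boundaryConst n a b P r lam j‖ ≤ K / ‖lam‖ ^ 2 := by
  refine ⟨(‖P a‖ + ‖P b‖) * ∑ j, 1 / ‖r j - 1‖, by positivity, fun lam j => ?_⟩
  have h1 : ‖P (basePoint a b (lam * (r j - 1)))‖ ≤ ‖P a‖ + ‖P b‖ := by
    unfold basePoint
    split_ifs <;> simp
  have h2 : 1 / ‖r j - 1‖ ≤ ∑ j, 1 / ‖r j - 1‖ :=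
    Finset.single_le_sum (f := fun j => 1 / ‖r j - 1‖) (fun _ _ => by positivity)
      (Finset.mem_univ j)
  have h3 : (1 : ℝ) / n ≤ 1 := by
    have : (1 : ℝ) ≤ n := by exact_mod_cast hn
    exact div_le_one_of_le₀ this (by positivity)
  have h4 : ‖boundaryConst n a b P r lam j‖ =
      (1 / n) * (‖P (basePoint a b (lam * (r j - 1)))‖ * (1 / ‖r j - 1‖)) / ‖lam‖ ^ 2 := by
    simp only [boundaryConst, norm_div, norm_mul, norm_root_eq_one hn hr, Complex.norm_natCast]
    simp only [div_eq_mul_inv, mul_inv]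
    ring
  rw [h4]
  refine div_le_div_of_nonneg_right ?_ (by positivity)
  refine (mul_le_of_le_one_left (by positivity) h3).trans ?_
  exact mul_le_mul h1 h2 (by positivity) (by positivity)

lemma continuousOn_primitive {a b : ℝ} (hab : a ≤ b) {f : ℝ → ℂ}
    (hf : IntervalIntegrable f volume a b) :
    ContinuousOn (fun x => ∫ t in a..x, f t) (Icc a b) := by
  rw [← uIcc_of_le hab]
  exact intervalIntegral.continuousOn_primitive_interval' hf left_mem_uIcc

lemma IsSystemSolution.second_order {n : ℕ} {a b : ℝ} {p : Fin (n - 1) → ℝ → ℂ} {r : Fin n → ℂ}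
    {k : Fin n} (hn : 3 ≤ n) (hab : a ≤ b) (hp : ∀ m, IntervalIntegrable (p m) volume a b)
    (hinj : Function.Injective r) (hr : ∀ j, r j ^ n = 1) (hk : r k = 1)
    {i₂ i₃ : Fin (n - 1)} (hi₂ : (i₂ : ℕ) = n - 2) (hi₃ : (i₃ : ℕ) = n - 3)
    {P P₃ q : ℝ → ℂ} (hP2 : P = p i₂) (hP3 : P₃ = p i₃)
    (hq : IntervalIntegrable q volume a b)
    (hP : ∀ x ∈ Icc a b, P x = P a + ∫ t in a..x, q t) :
    ∃ C : ℝ, ∀ (lam : ℂ) (η : ℝ), 1 ≤ ‖lam‖ → 1 / ‖lam‖ ≤ η →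
      (∀ j ≠ k, ∀ x ∈ Icc a b, ∀ φ ∈ ({P, fun t => P₃ t + P t * beta1 n a P t, q} : Set (ℝ → ℂ)),
        ‖∫ t in (basePoint a b (lam * (r j - 1)))..x,
          Complex.exp (lam * (r j - 1) * (x - t)) * φ t‖ ≤ η) →
      ∀ w, IsSystemSolution n a b p r k lam (boundaryConst n a b P r lam) w →
      ∀ j, ∀ x ∈ Icc a b,
        ‖w j x - ((if j = k then 1 + beta1 n a P x / lam +
            (-(1 / (n : ℂ)) * ∫ t in a..x, (P₃ t + P t * beta1 n a P t)) / lam ^ 2 else 0) +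
            r j * P x / (n * (r j - 1)) / lam ^ 2)‖ ≤ C * η / ‖lam‖ ^ 2 := by
  have hn0 : 0 < n := by omega
  obtain ⟨K, hK0, hK⟩ := exists_norm_boundaryConst_le (a := a) (b := b) hn0 hr P
  have hQ := intervalIntegrable_sum_norm hp
  set B := ∫ t in a..b, ∑ m, ‖p m t‖ with hB
  have hB0 : 0 ≤ B := intervalIntegral.integral_nonneg hab fun t _ => by positivity
  set D := ∑ j, 1 / ‖r j - 1‖ with hD
  have hD0 : 0 ≤ D := by positivity
  have hPi : IntervalIntegrable P volume a b := hP2 ▸ hp _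
  have hP3i : IntervalIntegrable P₃ volume a b := hP3 ▸ hp _
  have hb1 : ContinuousOn (beta1 n a P) (uIcc a b) := by
    rw [uIcc_of_le hab]
    exact continuousOn_const.mul (continuousOn_primitive hab hPi)
  have hRi : IntervalIntegrable (fun t => P₃ t + P t * beta1 n a P t) volume a b :=
    hP3i.add (hPi.mul_continuousOn hb1)
  set C₁ := K + 4 * n * B with hC1
  have hC10 : 0 ≤ C₁ := by positivity
  set C₂ := K + 1 + B * (n * (C₁ + 4)) with hC2
  have hC20 : 0 ≤ C₂ := by positivity
  refine ⟨1 + D + B * (n * (C₂ + C₁ + 4)), fun lam η hlam hη hRL w hw => ?_⟩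
  set s := ‖lam‖ with hs
  have hs0 : 0 < s := by linarith
  have hl0 : lam ≠ 0 := norm_pos_iff.1 hs0
  have hη0 : 0 ≤ η := le_trans (by positivity) hη
  have hss : 1 / s ^ 2 ≤ η / s := by
    rw [pow_two, ← div_div]; exact div_le_div_of_nonneg_right hη hs0.le
  have hss1 : 1 / s ^ 2 ≤ 1 / s := by
    rw [pow_two, ← div_div]
    exact div_le_div_of_nonneg_right (by rw [div_le_one hs0]; exact hlam) hs0.le
  have hsss : 1 / s ^ 3 ≤ η / s ^ 2 := by
    rw [pow_succ', ← div_div]; exact div_le_div_of_nonneg_right hη (by positivity)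
  have hF := fun j => intervalIntegrable_systemKernel_mul (r := r) (lam := lam) hp hw.cont j
  have hratio2 : lam ^ (n - 2) / lam ^ (n - 1) = 1 / lam := by
    rw [show n - 1 = n - 2 + 1 by omega, pow_succ]; field_simp
  have hratio3 : lam ^ (n - 3) / lam ^ (n - 1) = 1 / lam ^ 2 := by
    rw [show n - 1 = n - 3 + 2 by omega, pow_add]; field_simp
  have hrn := norm_root_div_le_one hn0 hr
  -- zeroth approximation
  have h0 : ∀ j, ∀ x ∈ Icc a b, ‖w j x - if j = k then 1 else 0‖ ≤ C₁ / s := by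
    intro j x hx
    refine (hw.norm_sub_le hn0 hab hp hr hlam j hx).trans ?_
    have h1 : K / s ^ 2 ≤ K / s := by
      rw [← mul_one_div K, ← mul_one_div K s]
      exact mul_le_mul_of_nonneg_left hss1 hK0
    rw [hC1, add_div]
    exact add_le_add ((hK lam j).trans h1) le_rfl
  have hv0 : ∀ m : ℕ, ∀ t ∈ Icc a b, ‖∑ l, r l ^ m * w l t - 1‖ ≤ n * (C₁ / s) := by
    intro m t ht
    have := norm_sum_pow_mul_sub_le hn0 hr m fun l => h0 l t ht
    rwa [sum_root_pow_mul_ite hk] at this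
  have hvb : ∀ m : ℕ, ∀ t ∈ Icc a b, ‖∑ l, r l ^ m * w l t‖ ≤ n * 4 := by
    intro m t ht
    have := norm_sum_pow_mul_sub_le (z := fun _ => 0) hn0 hr m (δ := 4)
      fun l => by simpa using hw.bound l t ht
    simpa using this
  -- first approximation of the integrand
  have hk1 : ∀ j, ∀ t ∈ Icc a b,
      ‖∑ l, systemKernel n p r lam j l t * w l t - -(r j / n) * (P t * (1 / lam))‖ ≤
        (∑ m, ‖p m t‖) * (n * (C₁ + 4) / s ^ 2) := by
    intro j t ht
    have := norm_sum_systemKernel_mul_add_le (p := p) (lam := lam) hn0 hr j (t := t)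
      (w := fun l => w l t) (δ := n * (C₁ + 4) / s ^ 2)
      (θ := fun m => if m = i₂ then 1 / lam else 0) (fun m => ?_)
    · simpa [← hP2] using this
    · split_ifs with hm
      · rw [hm, hi₂]
        simp only [hratio2]
        rw [← mul_sub_one, norm_mul, norm_div, norm_one]
        refine (mul_le_mul_of_nonneg_left (hv0 (n - 2) t ht) (by positivity)).trans ?_
        rw [show 1 / ‖lam‖ * (n * (C₁ / s)) = n * C₁ / s ^ 2 by rw [← hs]; field_simp]
        gcongr; linarith
      · have hm' : (m : ℕ) + 2 ≤ n - 1 := by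
          have : (m : ℕ) ≠ n - 2 := fun h => hm (Fin.ext (h.trans hi₂.symm))
          omega
        rw [sub_zero, norm_mul]
        refine (mul_le_mul (norm_pow_div_pow_le hlam hm') (hvb m t ht) (norm_nonneg _)
          (by positivity)).trans ?_
        rw [show 1 / ‖lam‖ ^ 2 * (n * 4 : ℝ) = n * 4 / s ^ 2 by rw [← hs]; field_simp]
        gcongr; linarith
  have hw1 : ∀ j, ∀ x ∈ Icc a b,
      ‖w j x - if j = k then 1 + beta1 n a P x / lam else 0‖ ≤ C₂ * (η / s) := by
    intro j x hx
    have hcmp := norm_integral_exp_mul_sub_le hab (basePoint_mem hab _) hx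
      (re_mul_sub_basePoint_nonpos hx (lam * (r j - 1))) (hF j)
      ((hPi.mul_const (1 / lam)).const_mul (-(r j / n))) hQ (hk1 j)
    have hmul : B * (n * (C₁ + 4) / s ^ 2) ≤ B * (n * (C₁ + 4)) * (η / s) := by
      rw [← mul_one_div (n * (C₁ + 4)), ← mul_assoc]
      exact mul_le_mul_of_nonneg_left hss (by positivity)
    split_ifs with hj
    · subst hj
      simp only [exp_integral_self hk] at hcmp
      rw [hw.eqn _ x hx, exp_integral_self hk, boundaryConst, hk]
      have hval : ∫ t in a..x, -(r j / n) * (P t * (1 / lam)) = beta1 n a P x / lam := by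
        rw [intervalIntegral.integral_const_mul, intervalIntegral.integral_mul_const, beta1, hk]
        ring
      rw [hval] at hcmp
      simp only [if_true, sub_self, mul_zero, div_zero, zero_mul, add_zero]
      rw [add_sub_add_left_eq_sub]
      refine (hcmp.trans hmul).trans ?_
      gcongr; linarith
    · rw [hw.eqn _ x hx, if_neg hj, zero_add, sub_zero]
      have hval : ∫ t in (basePoint a b (lam * (r j - 1)))..x,
          Complex.exp (lam * (r j - 1) * (x - t)) * (-(r j / n) * (P t * (1 / lam))) =
          -(r j / n) * (1 / lam) * ∫ t in (basePoint a b (lam * (r j - 1)))..x,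
          Complex.exp (lam * (r j - 1) * (x - t)) * P t := by
        rw [← intervalIntegral.integral_const_mul]
        refine intervalIntegral.integral_congr fun t _ => ?_
        ring
      rw [hval] at hcmp
      have hPη := hRL j hj x hx P (by simp)
      have h1 : ‖-(r j / n) * (1 / lam) * ∫ t in (basePoint a b (lam * (r j - 1)))..x,
          Complex.exp (lam * (r j - 1) * (x - t)) * P t‖ ≤ η / s := by
        rw [norm_mul, norm_mul, norm_neg, norm_div 1, norm_one, mul_assoc]
        refine (mul_le_of_le_one_left (by positivity) (hrn j)).trans ?_
        rw [one_div_mul_eq_div]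
        exact div_le_div_of_nonneg_right hPη hs0.le
      have h2 : ‖boundaryConst n a b P r lam j * Complex.exp (lam * (r j - 1) *
          (x - basePoint a b (lam * (r j - 1))))‖ ≤ K * (η / s) := by
        rw [norm_mul]
        refine (mul_le_of_le_one_right (norm_nonneg _) (norm_exp_mul_sub_le_one
          (re_mul_sub_basePoint_nonpos hx _) left_mem_uIcc)).trans ((hK lam j).trans ?_)
        rw [← mul_one_div K]
        exact mul_le_mul_of_nonneg_left hss hK0
      refine (norm_add_le _ _).trans ?_
      have h3 := (norm_le_insert' _ _).trans (add_le_add h1 (hcmp.trans hmul))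
      rw [hC2]
      linarith
  -- second approximation of the integrand
  have hk2 : ∀ j, ∀ t ∈ Icc a b,
      ‖∑ l, systemKernel n p r lam j l t * w l t - -(r j / n) * (P t * (1 / lam) +
          (P₃ t + P t * beta1 n a P t) * (1 / lam ^ 2))‖ ≤
        (∑ m, ‖p m t‖) * (n * (C₂ + C₁ + 4) * (η / s ^ 2)) := by
    intro j t ht
    have := norm_sum_systemKernel_mul_add_le (p := p) (lam := lam) hn0 hr j (t := t)
      (w := fun l => w l t) (δ := n * (C₂ + C₁ + 4) * (η / s ^ 2))
      (θ := fun m => (if m = i₂ then 1 / lam + beta1 n a P t / lam ^ 2 else 0) +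
        if m = i₃ then 1 / lam ^ 2 else 0) (fun m => ?_)
    · simp only [mul_add, Finset.sum_add_distrib, mul_ite, mul_zero, Finset.sum_ite_eq',
        Finset.mem_univ, if_true, ← hP2, ← hP3] at this
      convert this using 2 <;> ring
    · rcases lt_trichotomy ((m : ℕ) + 3) n with hm | hm | hm
      · have hm' : (m : ℕ) + 3 ≤ n - 1 := by omega
        rw [if_neg (fun h => by rw [h] at hm; omega),
          if_neg (fun h => by rw [h] at hm; omega), add_zero, sub_zero, norm_mul]
        refine (mul_le_mul (norm_pow_div_pow_le hlam hm') (hvb m t ht) (norm_nonneg _)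
          (by positivity)).trans ?_
        rw [mul_comm]
        refine (mul_le_mul_of_nonneg_left hsss (by positivity)).trans ?_
        gcongr; linarith
      · obtain rfl : m = i₃ := Fin.ext (by omega)
        rw [if_neg (fun h => by rw [h] at hm; omega), if_pos rfl, zero_add, hi₃]
        simp only [hratio3]
        rw [← mul_sub_one, norm_mul, norm_div, norm_one, norm_pow]
        refine (mul_le_mul_of_nonneg_left (hv0 (n - 3) t ht) (by positivity)).trans ?_
        rw [show 1 / ‖lam‖ ^ 2 * (n * (C₁ / s)) = n * C₁ * (1 / s ^ 3) by
          rw [← hs]; field_simp]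
        refine (mul_le_mul_of_nonneg_left hsss (by positivity)).trans ?_
        gcongr; linarith
      · obtain rfl : m = i₂ := Fin.ext (by omega)
        rw [if_pos rfl, if_neg (fun h => by rw [h] at hm; omega), add_zero, hi₂]
        simp only [hratio2]
        have := norm_sum_pow_mul_sub_le hn0 hr (n - 2) fun l => hw1 l t ht
        rw [sum_root_pow_mul_ite hk] at this
        rw [show ∀ v : ℂ, 1 / lam * v - (1 / lam + beta1 n a P t / lam ^ 2) =
          1 / lam * (v - (1 + beta1 n a P t / lam)) by intro v; field_simp,
          norm_mul, norm_div, norm_one]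
        refine (mul_le_mul_of_nonneg_left this (by positivity)).trans ?_
        rw [show 1 / ‖lam‖ * (n * (C₂ * (η / s))) = n * C₂ * (η / s ^ 2) by
          rw [← hs]; field_simp]
        gcongr; linarith
  intro j x hx
  have hcmp := norm_integral_exp_mul_sub_le hab (basePoint_mem hab _) hx
    (re_mul_sub_basePoint_nonpos hx (lam * (r j - 1))) (hF j)
    (((hPi.mul_const (1 / lam)).add (hRi.mul_const (1 / lam ^ 2))).const_mul (-(r j / n))) hQ
    (hk2 j)
  refine le_trans ?_ (mul_div_assoc _ _ _).ge
  by_cases hj : j = k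
  · subst hj
    simp only [exp_integral_self hk] at hcmp
    rw [hw.eqn _ x hx, exp_integral_self hk, boundaryConst, hk]
    have hsx : uIcc a x ⊆ uIcc a b := by
      rw [uIcc_of_le hab]; exact uIcc_subset_Icc (left_mem_Icc.2 hab) hx
    have hval : ∫ t in a..x, -(r j / n) * (P t * (1 / lam) +
          (P₃ t + P t * beta1 n a P t) * (1 / lam ^ 2)) = beta1 n a P x / lam +
          (-(1 / (n : ℂ)) * ∫ t in a..x, (P₃ t + P t * beta1 n a P t)) / lam ^ 2 := by
      rw [intervalIntegral.integral_const_mul, intervalIntegral.integral_add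
        ((hPi.mono_set hsx).mul_const _) ((hRi.mono_set hsx).mul_const _),
        intervalIntegral.integral_mul_const, intervalIntegral.integral_mul_const, beta1, hk]
      ring
    rw [hval] at hcmp
    simp only [if_true, sub_self, mul_zero, div_zero, zero_mul, zero_div, add_zero]
    rw [show ∀ I u v : ℂ, 1 + I - (1 + u + v) = I - (u + v) by intros; ring]
    refine hcmp.trans ?_
    rw [← mul_assoc]
    gcongr
    linarith
  · set μ := lam * (r j - 1) with hμ
    set c := basePoint a b μ with hc
    have hcI : c ∈ Icc a b := basePoint_mem hab μ
    have hsx : uIcc c x ⊆ uIcc a b := by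
      rw [uIcc_of_le hab]; exact uIcc_subset_Icc hcI hx
    have hr1 : r j - 1 ≠ 0 := fun h => hj (hinj (by rw [hk]; exact sub_eq_zero.1 h))
    have hμ0 : μ ≠ 0 := mul_ne_zero hl0 hr1
    have hnC : (n : ℂ) ≠ 0 := by exact_mod_cast hn0.ne'
    have hparts := mul_integral_exp_mul_eq (P := P) (c := c) (x := x) μ (hq.mono_set hsx) (by
      intro t ht
      have htI : t ∈ Icc a b := by rw [← uIcc_of_le hab]; exact hsx ht
      have hci : IntervalIntegrable q volume a c :=
        hq.mono_set (uIcc_subset_uIcc left_mem_uIcc (by rwa [uIcc_of_le hab]))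
      have hti : IntervalIntegrable q volume c t :=
        hq.mono_set ((uIcc_subset_uIcc left_mem_uIcc ht).trans hsx)
      rw [hP t htI, hP c hcI, add_assoc,
        intervalIntegral.integral_add_adjacent_intervals hci hti])
    have hval : ∫ t in c..x, Complex.exp (μ * (x - t)) * (-(r j / n) * (P t * (1 / lam) +
          (P₃ t + P t * beta1 n a P t) * (1 / lam ^ 2))) =
        -(r j / n) * (1 / lam * (∫ t in c..x, Complex.exp (μ * (x - t)) * P t) +
          1 / lam ^ 2 * ∫ t in c..x, Complex.exp (μ * (x - t)) *
            (P₃ t + P t * beta1 n a P t)) := by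
      rw [← intervalIntegral.integral_const_mul, ← intervalIntegral.integral_const_mul,
        ← intervalIntegral.integral_add, ← intervalIntegral.integral_const_mul]
      · refine intervalIntegral.integral_congr fun t _ => ?_
        ring
      · exact (((hPi.mono_set hsx).continuousOn_mul (by fun_prop))).const_mul _
      · exact (((hRi.mono_set hsx).continuousOn_mul (by fun_prop))).const_mul _
    rw [hval] at hcmp
    set I₁ := ∫ t in c..x, Complex.exp (μ * (x - t)) * P t
    set I₂ := ∫ t in c..x, Complex.exp (μ * (x - t)) * (P₃ t + P t * beta1 n a P t)
    set I₃ := ∫ t in c..x, Complex.exp (μ * (x - t)) * q t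
    have hI2 : ‖I₂‖ ≤ η := hRL j hj x hx _ (by simp)
    have hI3 : ‖I₃‖ ≤ η := hRL j hj x hx _ (by simp)
    have hI1 : I₁ = (I₃ - P x + Complex.exp (μ * (x - c)) * P c) / μ := by
      rw [eq_div_iff hμ0, mul_comm]; exact hparts
    rw [hw.eqn _ x hx, if_neg hj, if_neg hj, zero_add, zero_add, boundaryConst, ← hμ, ← hc]
    have hrest : ‖-(r j / n) * (1 / lam ^ 2) * I₂ + -(r j / n) * (1 / (r j - 1)) *
        (1 / lam ^ 2) * I₃‖ ≤ (1 + D) * (η / s ^ 2) := by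
      refine (norm_add_le _ _).trans ?_
      rw [add_mul, one_mul]
      refine add_le_add ?_ ?_
      · rw [norm_mul, norm_mul, norm_neg, norm_div 1, norm_one, norm_pow, mul_assoc]
        refine (mul_le_of_le_one_left (by positivity) (hrn j)).trans ?_
        rw [one_div_mul_eq_div]
        exact div_le_div_of_nonneg_right hI2 (by positivity)
      · rw [mul_assoc, mul_assoc, norm_mul, norm_neg]
        refine (mul_le_of_le_one_left (by positivity) (hrn j)).trans ?_
        rw [norm_mul, norm_mul, norm_div, norm_div, norm_one, norm_pow,
          one_div_mul_eq_div (‖lam‖ ^ 2)]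
        refine mul_le_mul ?_ (div_le_div_of_nonneg_right hI3 (sq_nonneg _))
          (div_nonneg (norm_nonneg _) (sq_nonneg _)) hD0
        exact Finset.single_le_sum (f := fun j => 1 / ‖r j - 1‖) (fun _ _ => by positivity)
          (Finset.mem_univ j)
    have hid : ∀ W : ℂ, r j * P c / (n * lam * μ) * Complex.exp (μ * (x - c)) + W -
        r j * P x / (n * (r j - 1)) / lam ^ 2 =
        (W - -(r j / n) * (1 / lam * I₁ + 1 / lam ^ 2 * I₂)) +
        (-(r j / n) * (1 / lam ^ 2) * I₂ + -(r j / n) * (1 / (r j - 1)) *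
        (1 / lam ^ 2) * I₃) := by
      intro W
      rw [hI1, hμ]
      field_simp
      ring
    rw [hid]
    refine (norm_add_le _ _).trans ((add_le_add hcmp hrest).trans (le_of_eq ?_))
    ring

/-- `d` is the tower of derivatives, on `[a,b]`, of a solution of
`y^{(n)} + ∑ m, p m * y^{(m)} = Λ * y`, in integrated form. -/
structure IsDerivTower (n : ℕ) (a b : ℝ) (p : Fin (n - 1) → ℝ → ℂ) (Λ : ℂ) (d : ℕ → ℝ → ℂ) :
    Prop where
  cont : ∀ ν < n, ContinuousOn (d ν) (Icc a b)
  step : ∀ ν < n, ∀ x ∈ Icc a b, ∀ y ∈ Icc a b, d ν x - d ν y = ∫ t in y..x, d (ν + 1) t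
  eqn : ∀ x ∈ Icc a b, d n x + ∑ m, p m x * d m x = Λ * d 0 x

namespace IsDerivTower

variable {n : ℕ} {a b c : ℝ} {p : Fin (n - 1) → ℝ → ℂ} {Λ : ℂ} {d lo hi : ℕ → ℝ → ℂ}

lemma intervalIntegrable (hd : IsDerivTower n a b p Λ d) (hn : 0 < n) (hab : a ≤ b)
    (hp : ∀ m, IntervalIntegrable (p m) volume a b) {ν : ℕ} (hν : ν ≤ n) :
    IntervalIntegrable (d ν) volume a b := by
  rcases hν.lt_or_eq with h | rfl
  · exact (uIcc_of_le hab ▸ hd.cont ν h).intervalIntegrable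
  · have hc : ∀ m < ν, ContinuousOn (d m) (uIcc a b) := fun m hm => uIcc_of_le hab ▸ hd.cont m hm
    have h1 : IntervalIntegrable (fun x => Λ * d 0 x - ∑ m, p m x * d m x) volume a b := by
      refine ((hc 0 hn).intervalIntegrable.const_mul Λ).sub ?_
      simpa only [Finset.sum_fn] using IntervalIntegrable.sum Finset.univ
        (f := fun (m : Fin (ν - 1)) x => p m x * d m x)
        fun m _ => (hp m).mul_continuousOn (hc m (by omega))
    refine h1.congr fun x hx => ?_
    rw [uIoc_of_le hab] at hx
    exact (eq_sub_of_add_eq (hd.eqn x (Ioc_subset_Icc_self hx))).symm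

lemma isSolutionODE {T : ℝ} {ρ : ℂ} (hd : IsDerivTower n 0 T p (ρ ^ n) d) (hn : 0 < n) (hT : 0 < T)
    (hp : ∀ m, IntervalIntegrable (p m) volume 0 T) : IsSolutionODE n T p ρ d := by
  have h0 : (0 : ℝ) ∈ Icc 0 T := left_mem_Icc.2 hT.le
  refine ⟨fun ν hν x hx => ?_, hd.intervalIntegrable hn hT.le hp le_rfl, fun x hx => ?_, ?_⟩
  · have hc : ContinuousOn (d (ν + 1)) (Icc 0 T) := hd.cont (ν + 1) (by omega)
    have hder : HasDerivWithinAt (fun u => ∫ t in (0 : ℝ)..u, d (ν + 1) t) (d (ν + 1) x)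
        (Icc 0 T) x := by
      have : Fact (x ∈ Icc 0 T) := ⟨hx⟩
      exact intervalIntegral.integral_hasDerivWithinAt_right
        ((hc.mono (by rw [uIcc_of_le hx.1]; exact Icc_subset_Icc_right hx.2)).intervalIntegrable)
        (hc.stronglyMeasurableAtFilter_nhdsWithin measurableSet_Icc x) (hc x hx)
    refine (hder.const_add (d ν 0)).congr (fun u hu => ?_) ?_
    · rw [← hd.step ν (by omega) u hu 0 h0]; ring
    · rw [← hd.step ν (by omega) x hx 0 h0]; ring
  · have := hd.step (n - 1) (by omega) x hx 0 h0
    rw [Nat.sub_add_cancel hn] at this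
    rw [← this]; ring
  · exact (ae_restrict_mem measurableSet_Icc).mono fun x hx => hd.eqn x hx

lemma sum_mul {ι : Type*} [Fintype ι] {d : ι → ℕ → ℝ → ℂ}
    (hd : ∀ i, IsDerivTower n a b p Λ (d i)) (hn : 0 < n) (hab : a ≤ b)
    (hp : ∀ m, IntervalIntegrable (p m) volume a b) (C : ι → ℂ) :
    IsDerivTower n a b p Λ fun ν x => ∑ i, d i ν x * C i where
  cont ν hν := continuousOn_finsetSum _ fun i _ => ((hd i).cont ν hν).mul continuousOn_const
  step ν hν x hx y hy := by
    have hyx : uIcc y x ⊆ uIcc a b := by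
      rw [uIcc_of_le hab]; exact uIcc_subset_Icc hy hx
    rw [intervalIntegral.integral_finsetSum fun i _ =>
      (((hd i).intervalIntegrable hn hab hp (Nat.succ_le_of_lt hν)).mono_set hyx).mul_const _,
      ← Finset.sum_sub_distrib]
    refine Finset.sum_congr rfl fun i _ => ?_
    rw [intervalIntegral.integral_mul_const, ← (hd i).step ν hν x hx y hy, sub_mul]
  eqn x hx := by
    simp only [Finset.mul_sum]
    rw [Finset.sum_comm, ← Finset.sum_add_distrib]
    refine Finset.sum_congr rfl fun i _ => ?_
    have := congrArg (· * C i) ((hd i).eqn x hx)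
    simpa only [add_mul, Finset.sum_mul, mul_assoc] using this

lemma glue (hlo : IsDerivTower n a c p Λ lo) (hhi : IsDerivTower n c b p Λ hi) (hn : 0 < n)
    (hac : a ≤ c) (hcb : c ≤ b) (hp : ∀ m, IntervalIntegrable (p m) volume a b)
    (heq : ∀ ν < n, lo ν c = hi ν c) :
    IsDerivTower n a b p Λ fun ν x => if x < c then lo ν x else hi ν x := by
  set d : ℕ → ℝ → ℂ := fun ν x => if x < c then lo ν x else hi ν x with hd
  have hcl : c ∈ Icc a c := right_mem_Icc.2 hac
  have hch : c ∈ Icc c b := left_mem_Icc.2 hcb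
  have heqn : lo n c = hi n c := by
    rw [eq_sub_of_add_eq (hlo.eqn c hcl), eq_sub_of_add_eq (hhi.eqn c hch), heq 0 hn]
    congr 1
    exact Finset.sum_congr rfl fun m _ => by rw [heq m (by omega)]
  have hdhi : ∀ ν, ∀ x, c ≤ x → d ν x = hi ν x := fun ν x hx => if_neg (not_lt.2 hx)
  have hdlo : ∀ ν ≤ n, ∀ x ≤ c, d ν x = lo ν x := by
    intro ν hν x hx
    rcases hx.lt_or_eq with h | rfl
    · exact if_pos h
    · rw [hdhi ν x le_rfl]
      rcases hν.lt_or_eq with h | rfl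
      · exact (heq ν h).symm
      · exact heqn.symm
  have hcab : c ∈ uIcc a b := by rw [uIcc_of_le (hac.trans hcb)]; exact ⟨hac, hcb⟩
  have hpl : ∀ m, IntervalIntegrable (p m) volume a c := fun m =>
    (hp m).mono_set (uIcc_subset_uIcc left_mem_uIcc hcab)
  have hph : ∀ m, IntervalIntegrable (p m) volume c b := fun m =>
    (hp m).mono_set (uIcc_subset_uIcc hcab right_mem_uIcc)
  have hil : ∀ ν ≤ n, IntervalIntegrable (d ν) volume a c := fun ν hν =>
    (hlo.intervalIntegrable hn hac hpl hν).congr fun x hx => by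
      rw [uIoc_of_le hac] at hx; exact (hdlo ν hν x hx.2).symm
  have hih : ∀ ν ≤ n, IntervalIntegrable (d ν) volume c b := fun ν hν =>
    (hhi.intervalIntegrable hn hcb hph hν).congr fun x hx => by
      rw [uIoc_of_le hcb] at hx; exact (hdhi ν x hx.1.le).symm
  have hstep : ∀ ν < n, ∀ x ∈ Icc a b, d ν x - d ν c = ∫ t in c..x, d (ν + 1) t := by
    intro ν hν x hx
    rcases le_total x c with h | h
    · rw [hdlo ν hν.le x h, hdlo ν hν.le c le_rfl, hlo.step ν hν x ⟨hx.1, h⟩ c hcl]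
      refine intervalIntegral.integral_congr fun t ht => ?_
      rw [uIcc_of_ge h] at ht
      exact (hdlo _ hν t ht.2).symm
    · rw [hdhi ν x h, hdhi ν c le_rfl, hhi.step ν hν x ⟨h, hx.2⟩ c hch]
      refine intervalIntegral.integral_congr fun t ht => ?_
      rw [uIcc_of_le h] at ht
      exact (hdhi _ t ht.1).symm
  refine ⟨fun ν hν => ?_, fun ν hν x hx y hy => ?_, fun x hx => ?_⟩
  · rw [← Icc_union_Icc_eq_Icc hac hcb]
    exact ((hlo.cont ν hν).congr fun x hx => hdlo ν hν.le x hx.2).union_of_isClosed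
      ((hhi.cont ν hν).congr fun x hx => hdhi ν x hx.1) isClosed_Icc isClosed_Icc
  · have hi : IntervalIntegrable (d (ν + 1)) volume a b := (hil _ hν).trans (hih _ hν)
    have hsub : ∀ z ∈ Icc a b, IntervalIntegrable (d (ν + 1)) volume c z := fun z hz =>
      hi.mono_set (uIcc_subset_uIcc hcab (by rwa [uIcc_of_le (hac.trans hcb)]))
    rw [← intervalIntegral.integral_interval_sub_left (hsub x hx) (hsub y hy),
      ← hstep ν hν x hx, ← hstep ν hν y hy, sub_sub_sub_cancel_right]
  · rcases le_total x c with h | h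
    · rw [hdlo n le_rfl x h, hdlo 0 n.zero_le x h, ← hlo.eqn x ⟨hx.1, h⟩]
      exact congrArg _ (Finset.sum_congr rfl fun m _ => by rw [hdlo m (by omega) x h])
    · rw [hdhi n x h, hdhi 0 x h, ← hhi.eqn x ⟨h, hx.2⟩]
      exact congrArg _ (Finset.sum_congr rfl fun m _ => by rw [hdhi m x h])

/-- Fundamental systems on two adjacent intervals combine to one on their union which extends the
system on the right. -/
lemma exists_glue_fundamental {lo hi : Fin n → ℕ → ℝ → ℂ}
    (hlo : ∀ k, IsDerivTower n a c p Λ (lo k)) (hhi : ∀ k, IsDerivTower n c b p Λ (hi k))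
    (hn : 0 < n) (hac : a ≤ c) (hcb : c ≤ b) (hp : ∀ m, IntervalIntegrable (p m) volume a b)
    (hdlo : ∀ x ∈ Icc a c, (Matrix.of fun ν k : Fin n => lo k ν x).det ≠ 0)
    (hdhi : ∀ x ∈ Icc c b, (Matrix.of fun ν k : Fin n => hi k ν x).det ≠ 0) :
    ∃ Y : Fin n → ℕ → ℝ → ℂ, (∀ k, IsDerivTower n a b p Λ (Y k)) ∧
      (∀ x ∈ Icc a b, (Matrix.of fun ν k : Fin n => Y k ν x).det ≠ 0) ∧
      ∀ k ν, ∀ x ∈ Icc c b, Y k ν x = hi k ν x := by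
  set L : ℝ → Matrix (Fin n) (Fin n) ℂ := fun x => Matrix.of fun ν k : Fin n => lo k ν x with hL
  set H : ℝ → Matrix (Fin n) (Fin n) ℂ := fun x => Matrix.of fun ν k : Fin n => hi k ν x with hH
  have hLc : IsUnit (L c).det := (hdlo c (right_mem_Icc.2 hac)).isUnit
  set C := (L c)⁻¹ * H c with hC
  have hLC : L c * C = H c := by rw [hC, ← mul_assoc, Matrix.mul_nonsing_inv _ hLc, one_mul]
  have hCdet : C.det ≠ 0 := fun h => hdhi c (left_mem_Icc.2 hcb) (by
    change (H c).det = 0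
    rw [← hLC, Matrix.det_mul, h, mul_zero])
  have hpl : ∀ m, IntervalIntegrable (p m) volume a c := fun m =>
    (hp m).mono_set (uIcc_subset_uIcc left_mem_uIcc (by
      rw [uIcc_of_le (hac.trans hcb)]; exact ⟨hac, hcb⟩))
  refine ⟨fun k ν x => if x < c then ∑ i, lo i ν x * C i k else hi k ν x, fun k => ?_,
    fun x hx => ?_, fun k ν x hx => if_neg (not_lt.2 hx.1)⟩
  · refine (sum_mul hlo hn hac hpl fun i => C i k).glue (hhi k) hn hac hcb hp fun ν hν => ?_
    simpa [Matrix.mul_apply, hL, hH] using congrFun (congrFun hLC ⟨ν, hν⟩) k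
  · by_cases h : x < c
    · have : (Matrix.of fun ν k : Fin n => if x < c then ∑ i, lo i ν x * C i k else hi k ν x) =
          L x * C := by
        ext ν k
        simp [h, hL, Matrix.mul_apply]
      rw [this, Matrix.det_mul]
      exact mul_ne_zero (hdlo x ⟨hx.1, h.le⟩) hCdet
    · simp only [h, if_false]
      exact hdhi x ⟨not_lt.1 h, hx.2⟩

end IsDerivTower

/-- The tower `λ^ν e^{λx} ∑ j, r j ^ ν * w j x`, `ν < n`, completed at `ν = n` by means of the
differential equation. -/
noncomputable def systemTower (n : ℕ) (p : Fin (n - 1) → ℝ → ℂ) (r : Fin n → ℂ) (lam : ℂ)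
    (w : Fin n → ℝ → ℂ) (ν : ℕ) (x : ℝ) : ℂ :=
  if ν < n then lam ^ ν * Complex.exp (lam * x) * ∑ j, r j ^ ν * w j x
  else lam ^ n * (Complex.exp (lam * x) * ∑ j, w j x) -
    ∑ m : Fin (n - 1), p m x * (lam ^ (m : ℕ) * Complex.exp (lam * x) * ∑ j, r j ^ (m : ℕ) * w j x)

namespace IsSystemSolution

variable {n : ℕ} {a b : ℝ} {p : Fin (n - 1) → ℝ → ℂ} {r : Fin n → ℂ} {lam : ℂ} {k : Fin n}
  {κ : Fin n → ℂ} {w : Fin n → ℝ → ℂ}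

lemma exp_mul_sub_exp_mul (hw : IsSystemSolution n a b p r k lam κ w) (hab : a ≤ b)
    (hp : ∀ m, IntervalIntegrable (p m) volume a b) (hk : r k = 1) (j : Fin n) {x y : ℝ}
    (hx : x ∈ Icc a b) (hy : y ∈ Icc a b) :
    Complex.exp (lam * x) * w j x - Complex.exp (lam * y) * w j y =
      ∫ t in y..x, (lam * r j * (Complex.exp (lam * t) * w j t) +
        ∑ l, systemKernel n p r lam j l t * (Complex.exp (lam * t) * w l t)) := by
  set c := basePoint a b (lam * (r j - 1)) with hc
  rw [← uIcc_of_le hab] at hx hy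
  have hF : IntervalIntegrable (fun t : ℝ => ∑ l, systemKernel n p r lam j l t *
      (Complex.exp (lam * t) * w l t)) volume a b := intervalIntegrable_systemKernel_mul hp
    (fun l => (show Continuous fun t : ℝ => Complex.exp (lam * t) by fun_prop).mul (hw.cont l)) j
  refine variation_of_constants (u := fun t => Complex.exp (lam * t) * w j t) (lam * r j)
    ((if j = k then 1 else 0) + κ j * Complex.exp (-(lam * (r j - 1) * c))) hF
    (by rw [uIcc_of_le hab]; exact basePoint_mem hab (lam * (r j - 1))) hx hy fun t ht => ?_
  rw [uIcc_of_le hab] at ht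
  rw [hw.eqn j t ht, ← hc, mul_add, mul_add (Complex.exp (lam * r j * t))]
  congr 1
  · rw [mul_add, mul_add]
    congr 1
    · split_ifs with h
      · simp [h, hk]
      · simp
    · rw [mul_left_comm, mul_left_comm _ (κ j), ← Complex.exp_add, ← Complex.exp_add]
      ring_nf
  · rw [← intervalIntegral.integral_const_mul, ← intervalIntegral.integral_const_mul]
    refine intervalIntegral.integral_congr fun τ _ => ?_
    have : ∑ l, systemKernel n p r lam j l τ * (Complex.exp (lam * τ) * w l τ) =
        Complex.exp (lam * τ) * ∑ l, systemKernel n p r lam j l τ * w l τ := by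
      rw [Finset.mul_sum]
      exact Finset.sum_congr rfl fun l _ => by ring
    simp only [this]
    simp only [← mul_assoc, ← Complex.exp_add]
    ring_nf

lemma isDerivTower (hw : IsSystemSolution n a b p r k lam κ w) (hn : 0 < n) (hab : a ≤ b)
    (hp : ∀ m, IntervalIntegrable (p m) volume a b) (hinj : Function.Injective r)
    (hr : ∀ j, r j ^ n = 1) (hk : r k = 1) (hlam : lam ≠ 0) :
    IsDerivTower n a b p (lam ^ n) (systemTower n p r lam w) where
  cont ν hν := by
    have hc := hw.cont
    have : systemTower n p r lam w ν =
        fun x : ℝ => lam ^ ν * Complex.exp (lam * x) * ∑ j, r j ^ ν * w j x := by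
      ext x; exact if_pos hν
    rw [this]
    fun_prop
  step ν hν x hx y hy := by
    have hyx : uIcc y x ⊆ uIcc a b := by
      rw [uIcc_of_le hab]; exact uIcc_subset_Icc hy hx
    have hval : ∀ t : ℝ, systemTower n p r lam w ν t =
        ∑ j, lam ^ ν * r j ^ ν * (Complex.exp (lam * t) * w j t) := by
      intro t
      rw [systemTower, if_pos hν, Finset.mul_sum]
      exact Finset.sum_congr rfl fun j _ => by ring
    have hz : ∀ l, Continuous fun t : ℝ => Complex.exp (lam * t) * w l t := fun l =>
      (show Continuous fun t : ℝ => Complex.exp (lam * t) by fun_prop).mul (hw.cont l)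
    rw [hval, hval, ← Finset.sum_sub_distrib]
    simp only [← mul_sub, hw.exp_mul_sub_exp_mul hab hp hk _ hx hy,
      ← intervalIntegral.integral_const_mul]
    rw [← intervalIntegral.integral_finsetSum fun j _ => ?_]
    · refine intervalIntegral.integral_congr fun t _ => ?_
      simp only [sum_systemKernel_mul, mul_add, Finset.sum_add_distrib]
      set Φ := ∑ m : Fin (n - 1), p m t * (lam ^ (m : ℕ) / lam ^ (n - 1) *
        ∑ l, r l ^ (m : ℕ) * (Complex.exp (lam * t) * w l t)) with hΦ
      have h1 : ∑ j, lam ^ ν * r j ^ ν * (lam * r j * (Complex.exp (lam * t) * w j t)) =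
          lam ^ (ν + 1) * Complex.exp (lam * t) * ∑ j, r j ^ (ν + 1) * w j t := by
        rw [Finset.mul_sum]
        exact Finset.sum_congr rfl fun j _ => by ring
      have h2 : ∑ j, lam ^ ν * r j ^ ν * (-(r j / n) * Φ) =
          -(lam ^ ν / n * Φ) * ∑ j, r j ^ (ν + 1) := by
        rw [Finset.mul_sum]
        exact Finset.sum_congr rfl fun j _ => by ring
      rw [h1, h2, systemTower]
      split_ifs with h
      · rw [sum_pow_roots_eq_zero hn hinj hr ν.succ_pos h, mul_zero, add_zero]
      · obtain rfl : n = ν + 1 := by omega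
        have hn0 : ((ν + 1 : ℕ) : ℂ) ≠ 0 := by exact_mod_cast hn.ne'
        simp only [hr, one_mul, Finset.sum_const, Finset.card_univ, Fintype.card_fin,
          nsmul_eq_mul, mul_one]
        rw [sub_eq_add_neg, mul_assoc, neg_mul, mul_right_comm, div_mul_cancel₀ _ hn0, hΦ]
        refine congrArg₂ _ rfl (congrArg Neg.neg ?_)
        rw [Finset.mul_sum]
        refine Finset.sum_congr rfl fun m _ => ?_
        have h3 : ∑ l : Fin (ν + 1), r l ^ (m : ℕ) * (Complex.exp (lam * t) * w l t) =
            Complex.exp (lam * t) * ∑ l : Fin (ν + 1), r l ^ (m : ℕ) * w l t := by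
          rw [Finset.mul_sum]
          exact Finset.sum_congr rfl fun l _ => by ring
        rw [h3, show lam ^ (ν + 1 - 1) = lam ^ ν from rfl]
        field_simp
    · refine (IntervalIntegrable.add ?_ ?_).const_mul _
      · exact (continuous_const.mul (hz j)).intervalIntegrable _ _
      · exact (intervalIntegrable_systemKernel_mul hp hz j).mono_set hyx
  eqn x _ := by
    have h0 : systemTower n p r lam w 0 x = Complex.exp (lam * x) * ∑ j, w j x := by
      simp [systemTower, hn]
    have hm : ∀ m : Fin (n - 1), systemTower n p r lam w m x =
        lam ^ (m : ℕ) * Complex.exp (lam * x) * ∑ j, r j ^ (m : ℕ) * w j x := fun m =>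
      if_pos (by omega)
    simp only [h0, hm]
    rw [systemTower, if_neg (lt_irrefl n), sub_add_cancel]

end IsSystemSolution

lemma det_ne_zero_of_norm_sub_one_le {n : ℕ} {W : Matrix (Fin n) (Fin n) ℂ}
    (hW : ∀ j k, ‖W j k - if j = k then 1 else 0‖ ≤ 1 / (2 * n)) : W.det ≠ 0 := by
  refine det_ne_zero_of_sum_row_lt_diag fun j => ?_
  have hn : (0 : ℝ) < n := by exact_mod_cast j.pos
  have h1 : 1 - 1 / (2 * n : ℝ) ≤ ‖W j j‖ := by
    have h := hW j j
    rw [if_pos rfl, norm_sub_rev] at h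
    have := norm_sub_norm_le (1 : ℂ) (W j j)
    rw [norm_one] at this
    linarith
  have h2 : ∑ l ∈ Finset.univ.erase j, ‖W j l‖ ≤ (n - 1 : ℝ) * (1 / (2 * n)) := by
    refine (Finset.sum_le_card_nsmul _ _ (1 / (2 * n : ℝ)) fun l hl => ?_).trans_eq ?_
    · have h := hW j l
      rwa [if_neg (Finset.ne_of_mem_erase hl).symm, sub_zero] at h
    · rw [Finset.card_erase_of_mem (Finset.mem_univ j), Finset.card_univ, Fintype.card_fin,
        nsmul_eq_mul, Nat.cast_pred j.pos]
  refine h2.trans_lt (lt_of_lt_of_le ?_ h1)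
  have h3 : (n : ℝ) * (1 / (2 * n)) = 1 / 2 := by field_simp
  rw [sub_mul, one_mul, h3]
  norm_num

lemma det_systemTower_ne_zero {n : ℕ} {p : Fin (n - 1) → ℝ → ℂ} {R : Fin n → ℂ}
    (hinj : Function.Injective R) (hR : ∀ j, R j ≠ 0) {ρ : ℂ} (hρ : ρ ≠ 0)
    {w : Fin n → Fin n → ℝ → ℂ} {x : ℝ}
    (hw : ∀ j k, ‖w k j x - if j = k then 1 else 0‖ ≤ 1 / (2 * n)) :
    (Matrix.of fun ν k : Fin n =>
      systemTower n p (fun j => R j / R k) (ρ * R k) (w k) ν x).det ≠ 0 := by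
  have hfac : (Matrix.of fun ν k : Fin n =>
      systemTower n p (fun j => R j / R k) (ρ * R k) (w k) ν x) =
      Matrix.diagonal (fun ν : Fin n => ρ ^ (ν : ℕ)) * (Matrix.vandermonde R).transpose *
        Matrix.of (fun j k => w k j x) *
        Matrix.diagonal (fun k => Complex.exp (ρ * R k * x)) := by
    ext ν k
    rw [Matrix.mul_diagonal, mul_assoc, Matrix.diagonal_mul, Matrix.mul_apply]
    simp only [Matrix.of_apply, systemTower, ν.isLt, if_true, Matrix.transpose_apply,
      Matrix.vandermonde_apply, Finset.mul_sum, Finset.sum_mul]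
    refine Finset.sum_congr rfl fun j _ => ?_
    rw [mul_pow, div_pow]
    have := pow_ne_zero (ν : ℕ) (hR k)
    field_simp
  rw [hfac, Matrix.det_mul, Matrix.det_mul, Matrix.det_mul, Matrix.det_diagonal,
    Matrix.det_diagonal, Matrix.det_transpose]
  refine mul_ne_zero (mul_ne_zero (mul_ne_zero ?_ ?_) ?_) ?_
  · exact Finset.prod_ne_zero_iff.2 fun ν _ => pow_ne_zero _ hρ
  · exact Matrix.det_vandermonde_ne_zero_iff.2 hinj
  · exact det_ne_zero_of_norm_sub_one_le hw
  · exact Finset.prod_ne_zero_iff.2 fun k _ => Complex.exp_ne_zero _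

/-- For large `|ρ|` the systems for all exponents `ρ * R k` have solutions close to the identity
matrix. -/
lemma exists_isSystemSolution_forall {n : ℕ} {a b : ℝ} {p : Fin (n - 1) → ℝ → ℂ} {R : Fin n → ℂ}
    (hn : 0 < n) (hab : a ≤ b) (hp : ∀ m, IntervalIntegrable (p m) volume a b)
    (hR : ∀ j, R j ^ n = 1) {κ : ℂ → Fin n → Fin n → ℂ} {K : ℝ}
    (hκ : ∀ ρ, 1 ≤ ‖ρ‖ → ∀ k j, ‖κ ρ k j‖ ≤ K / ‖ρ‖) :
    ∃ ρ₀ : ℝ, 1 ≤ ρ₀ ∧ ∃ w : ℂ → Fin n → Fin n → ℝ → ℂ, ∀ ρ, ρ₀ ≤ ‖ρ‖ →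
      (∀ k, IsSystemSolution n a b p (fun j => R j / R k) k (ρ * R k) (κ ρ k) (w ρ k)) ∧
      ∀ j k, ∀ x ∈ Icc a b, ‖w ρ k j x - if j = k then 1 else 0‖ ≤ 1 / (2 * n) := by
  set B := ∫ t in a..b, ∑ m, ‖p m t‖ with hB
  have hB0 : 0 ≤ B := intervalIntegral.integral_nonneg hab fun t _ => by positivity
  have hK : 0 ≤ K := by
    have := (norm_nonneg _).trans (hκ 1 (by simp) ⟨0, hn⟩ ⟨0, hn⟩)
    simpa using this
  have hn0 : (0 : ℝ) < n := by exact_mod_cast hn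
  have hr : ∀ k j, (R j / R k) ^ n = 1 := fun k j => by rw [div_pow, hR, hR, div_one]
  have hnorm : ∀ ρ : ℂ, ∀ k, ‖ρ * R k‖ = ‖ρ‖ := fun ρ k => by
    rw [norm_mul, norm_root_eq_one hn hR, mul_one]
  have hex : ∀ ρ : ℂ, ∃ w : Fin n → Fin n → ℝ → ℂ, 1 + K + 2 * n * (K + 4 * n * B) ≤ ‖ρ‖ →
      ∀ k, IsSystemSolution n a b p (fun j => R j / R k) k (ρ * R k) (κ ρ k) (w k) := by
    intro ρ
    by_cases h : 1 + K + 2 * n * (K + 4 * n * B) ≤ ‖ρ‖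
    · have h1 : 0 ≤ 2 * n * K := by positivity
      have h2 : 0 ≤ n * B := by positivity
      have h3 : (1 : ℝ) ≤ n := by exact_mod_cast hn
      have h4 : n * B ≤ n * (n * B) := le_mul_of_one_le_left h2 h3
      have h5 : 0 ≤ 2 * n * (K + 4 * n * B) := by positivity
      choose w hw using fun k => exists_isSystemSolution (p := p) (lam := ρ * R k) (κ := κ ρ k)
        hn hab hp (hr k) k (by rw [hnorm]; linarith) (by rw [hnorm, ← hB]; nlinarith)
        (fun j => (hκ ρ (by linarith) k j).trans (div_le_one_of_le₀ (by linarith) (norm_nonneg _)))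
      exact ⟨w, fun _ => hw⟩
    · exact ⟨0, fun h' => absurd h' h⟩
  choose w hw using hex
  refine ⟨1 + K + 2 * n * (K + 4 * n * B), ?_, w, fun ρ hρ => ⟨hw ρ hρ, fun j k x hx => ?_⟩⟩
  · have : 0 ≤ 2 * n * (K + 4 * n * B) := by positivity
    linarith
  · have h5 : 0 ≤ 2 * n * (K + 4 * n * B) := by positivity
    have hρ0 : 0 < ‖ρ‖ := by linarith
    refine ((hw ρ hρ k).norm_sub_le hn hab hp (hr k) (by rw [hnorm]; linarith) j hx).trans ?_
    rw [hnorm, ← hB]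
    calc ‖κ ρ k j‖ + 4 * n * B / ‖ρ‖ ≤ (K + 4 * n * B) / ‖ρ‖ := by
          rw [add_div]; exact add_le_add (hκ ρ (by linarith) k j) le_rfl
      _ ≤ 1 / (2 * n) := by
          rw [div_le_div_iff₀ hρ0 (by positivity)]
          linarith

lemma norm_systemTower_sub_le {n : ℕ} {α : ℝ} {p : Fin (n - 1) → ℝ → ℂ} {r : Fin n → ℂ}
    {lam : ℂ} {k : Fin n} {w : Fin n → ℝ → ℂ} {P P₃ : ℝ → ℂ} {x δ : ℝ} (hn : 0 < n)
    (hinj : Function.Injective r) (hr : ∀ j, r j ^ n = 1) (hk : r k = 1)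
    (hw : ∀ j, ‖w j x - ((if j = k then 1 + beta1 n α P x / lam +
      (-(1 / (n : ℂ)) * ∫ t in α..x, (P₃ t + P t * beta1 n α P t)) / lam ^ 2 else 0) +
      r j * P x / (n * (r j - 1)) / lam ^ 2)‖ ≤ δ) {ν : ℕ} (hν : ν < n) :
    ‖systemTower n p r lam w ν x - lam ^ ν * Complex.exp (lam * x) *
      (1 + beta1 n α P x / lam +
        (beta2 n α P₃ P x + (ν : ℂ) * (-(P x) / (n : ℂ))) / lam ^ 2)‖ ≤
      n * δ * ‖lam ^ ν * Complex.exp (lam * x)‖ := by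
  have h := norm_sum_pow_mul_sub_le hn hr ν hw
  simp only [mul_add, Finset.sum_add_distrib, sum_root_pow_mul_ite hk] at h
  have hsum : ∑ j, r j ^ ν * (r j * P x / (n * (r j - 1)) / lam ^ 2) =
      P x / n * (((n : ℂ) - 1) / 2 - ν) / lam ^ 2 := by
    rw [← sum_pow_div_sub_one hn hinj hr hk hν, Finset.mul_sum, Finset.sum_div]
    refine Finset.sum_congr rfl fun j _ => ?_
    simp only [div_eq_mul_inv, mul_inv]
    ring
  rw [systemTower, if_pos hν, ← mul_sub, norm_mul, mul_comm (‖_‖)]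
  refine mul_le_mul_of_nonneg_right (le_of_eq_of_le (congrArg _ ?_) h) (norm_nonneg _)
  rw [hsum, beta2]
  ring

lemma exists_forall_norm_integral_exp_le {a b : ℝ} (hab : a ≤ b) {s : Set (ℝ → ℂ)}
    (hs : s.Finite) (hi : ∀ φ ∈ s, IntervalIntegrable φ volume a b) {η : ℝ} (hη : 0 < η) :
    ∃ M : ℝ, 0 ≤ M ∧ ∀ φ ∈ s, ∀ μ : ℂ, M ≤ ‖μ‖ → ∀ x ∈ Icc a b,
      ‖∫ t in (basePoint a b μ)..x, Complex.exp (μ * (x - t)) * φ t‖ ≤ η := by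
  have h : ∀ φ, ∃ M : ℝ, φ ∈ s → ∀ μ : ℂ, M ≤ ‖μ‖ → ∀ x ∈ Icc a b,
      ‖∫ t in (basePoint a b μ)..x, Complex.exp (μ * (x - t)) * φ t‖ ≤ η := by
    intro φ
    by_cases hφ : φ ∈ s
    · obtain ⟨M, hM⟩ := riemann_lebesgue_exp hab (hi φ hφ) hη
      exact ⟨M, fun _ μ hμ x hx =>
        hM μ hμ _ (basePoint_mem hab μ) x hx (re_mul_sub_basePoint_nonpos hx μ)⟩
    · exact ⟨0, fun h => absurd h hφ⟩
  choose M hM using h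
  obtain ⟨N, hN⟩ := (hs.image M).bddAbove
  exact ⟨max N 0, le_max_right _ _, fun φ hφ μ hμ =>
    hM φ hφ μ ((hN (mem_image_of_mem M hφ)).trans ((le_max_left _ _).trans hμ))⟩

/-- For `n ≥ 3` and `p_{n−2}` absolutely continuous on `[α,T]` with
integrable derivative, there exist `ρ_* > 0` and a fundamental system of solutions of
(1.1) for `ρ ∈ S̄`, `|ρ| ≥ ρ_*`, with the second-order asymptotics
`y_k^{(ν)}(x,ρ) = (ρR_k)^ν e^{ρR_k x}(1 + β₁(x)/(ρR_k) + (β₂(x)+νβ₁'(x))/(ρR_k)² + o(1/ρ²))`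
uniformly in `x ∈ [α,T]`, where `β₁'(x) = −p_{n−2}(x)/n`. -/
theorem birkhoff_fss_second_order (n : ℕ) (hn : 3 ≤ n) (T α : ℝ) (hT : 0 < T)
    (hα : α ∈ Set.Ico 0 T)
    (R : Fin n → ℂ) (hinj : Function.Injective R) (hroot : ∀ j, R j ^ n = 1)
    (p : Fin (n - 1) → ℝ → ℂ)
    (hp : ∀ m, IntervalIntegrable (p m) volume 0 T)
    (hac : ∃ q : ℝ → ℂ, IntervalIntegrable q volume α T ∧
        ∀ x ∈ Set.Icc α T, p ⟨n - 2, by omega⟩ x = p ⟨n - 2, by omega⟩ α + ∫ t in α..x, q t)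
    (S : Set ℂ) (hS : IsOpen S)
    (hord : ∀ ρ ∈ S, ∀ k l : Fin n, k < l → (ρ * R k).re < (ρ * R l).re) :
    ∃ ρstar : ℝ, 0 < ρstar ∧ ∃ Y : Fin n → ℂ → ℕ → ℝ → ℂ,
      -- each `y_k(·,ρ)` is a solution of (1.1)
      (∀ k : Fin n, ∀ ρ ∈ closure S, ρstar ≤ ‖ρ‖ → IsSolutionODE n T p ρ (Y k ρ)) ∧
      -- fundamental system: the Wronskian does not vanish
      (∀ ρ ∈ closure S, ρstar ≤ ‖ρ‖ → ∀ x ∈ Set.Icc (0 : ℝ) T,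
          (Matrix.of fun ν k : Fin n => Y k ρ (ν : ℕ) x).det ≠ 0) ∧
      -- the second-order asymptotics, uniformly in `x ∈ [α,T]`
      (∀ ε > (0 : ℝ), ∃ ρ₀ : ℝ, ∀ ρ ∈ closure S, ρstar ≤ ‖ρ‖ → ρ₀ ≤ ‖ρ‖ →
          ∀ k : Fin n, ∀ ν < n, ∀ x ∈ Set.Icc α T,
            ‖Y k ρ ν x - (ρ * R k) ^ ν * Complex.exp (ρ * R k * x) *
                (1 + beta1 n α (p ⟨n - 2, by omega⟩) x / (ρ * R k) +
                  (beta2 n α (p ⟨n - 3, by omega⟩) (p ⟨n - 2, by omega⟩) x +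
                      (ν : ℂ) * (-(p ⟨n - 2, by omega⟩ x) / (n : ℂ))) / (ρ * R k) ^ 2)‖
              ≤ ε * ‖(ρ * R k) ^ ν * Complex.exp (ρ * R k * x)‖ / ‖ρ‖ ^ 2) := by
  have hn0 : 0 < n := by omega
  obtain ⟨q, hq, hP⟩ := hac
  set P := p ⟨n - 2, by omega⟩ with hP2
  set P₃ := p ⟨n - 3, by omega⟩ with hP3
  have hαT : α ≤ T := hα.2.le
  have hα0 : α ∈ uIcc 0 T := by rw [uIcc_of_le hT.le]; exact ⟨hα.1, hαT⟩
  have hplo : ∀ m, IntervalIntegrable (p m) volume 0 α := fun m =>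
    (hp m).mono_set (uIcc_subset_uIcc left_mem_uIcc hα0)
  have hphi : ∀ m, IntervalIntegrable (p m) volume α T := fun m =>
    (hp m).mono_set (uIcc_subset_uIcc hα0 right_mem_uIcc)
  have hR0 : ∀ j, R j ≠ 0 := fun j h => by
    have := hroot j
    rw [h, zero_pow hn0.ne'] at this
    exact zero_ne_one this
  have hr : ∀ k j, (R j / R k) ^ n = 1 := fun k j => by rw [div_pow, hroot, hroot, div_one]
  have hrinj : ∀ k, Function.Injective fun j => R j / R k := fun k i j h =>
    hinj ((div_left_inj' (hR0 k)).1 h)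
  have hrk : ∀ k, R k / R k = 1 := fun k => div_self (hR0 k)
  have hnorm : ∀ (ρ : ℂ) k, ‖ρ * R k‖ = ‖ρ‖ := fun ρ k => by
    rw [norm_mul, norm_root_eq_one hn0 hroot, mul_one]
  have hpow : ∀ (ρ : ℂ) k, (ρ * R k) ^ n = ρ ^ n := fun ρ k => by
    rw [mul_pow, hroot, mul_one]
  -- the boundary constants on `[α,T]`
  choose K hK0 hK using fun k =>
    exists_norm_boundaryConst_le (a := α) (b := T) hn0 (hr k) P
  have hκ : ∀ ρ : ℂ, 1 ≤ ‖ρ‖ → ∀ k j,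
      ‖boundaryConst n α T P (fun j => R j / R k) (ρ * R k) j‖ ≤ (∑ k, K k) / ‖ρ‖ := by
    intro ρ hρ k j
    refine (hK k (ρ * R k) j).trans ?_
    rw [hnorm]
    exact div_le_div₀ (Finset.sum_nonneg fun k _ => hK0 k)
      (Finset.single_le_sum (fun k _ => hK0 k) (Finset.mem_univ k)) (by linarith)
      (le_self_pow₀ hρ two_ne_zero)
  obtain ⟨ρ₁, hρ₁, whi, hwhi⟩ := exists_isSystemSolution_forall hn0 hαT hphi hroot
    (κ := fun ρ k => boundaryConst n α T P (fun j => R j / R k) (ρ * R k)) hκ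
  obtain ⟨ρ₂, -, wlo, hwlo⟩ := exists_isSystemSolution_forall hn0 hα.1 hplo hroot
    (κ := fun _ _ _ => 0) (K := 0) (by simp)
  have hglue : ∀ ρ : ℂ, ∃ Y : Fin n → ℕ → ℝ → ℂ, max ρ₁ ρ₂ ≤ ‖ρ‖ →
      (∀ k, IsDerivTower n 0 T p (ρ ^ n) (Y k)) ∧
      (∀ x ∈ Icc 0 T, (Matrix.of fun ν k : Fin n => Y k ν x).det ≠ 0) ∧
      ∀ k ν, ∀ x ∈ Icc α T,
        Y k ν x = systemTower n p (fun j => R j / R k) (ρ * R k) (whi ρ k) ν x := by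
    intro ρ
    by_cases hρ : max ρ₁ ρ₂ ≤ ‖ρ‖
    · obtain ⟨h1, h2⟩ := hwhi ρ ((le_max_left _ _).trans hρ)
      obtain ⟨h3, h4⟩ := hwlo ρ ((le_max_right _ _).trans hρ)
      have hρ0 : ρ ≠ 0 := norm_pos_iff.1
        (zero_lt_one.trans_le (hρ₁.trans ((le_max_left _ _).trans hρ)))
      have hl : ∀ k, ρ * R k ≠ 0 := fun k => mul_ne_zero hρ0 (hR0 k)
      obtain ⟨Y, hY⟩ := IsDerivTower.exists_glue_fundamental
        (fun k => hpow ρ k ▸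
          (h3 k).isDerivTower hn0 hα.1 hplo (hrinj k) (hr k) (hrk k) (hl k))
        (fun k => hpow ρ k ▸
          (h1 k).isDerivTower hn0 hαT hphi (hrinj k) (hr k) (hrk k) (hl k))
        hn0 hα.1 hαT hp
        (fun x hx => det_systemTower_ne_zero hinj hR0 hρ0 fun j k => h4 j k x hx)
        (fun x hx => det_systemTower_ne_zero hinj hR0 hρ0 fun j k => h2 j k x hx)
      exact ⟨Y, fun _ => hY⟩
    · exact ⟨0, fun h => absurd h hρ⟩
  choose Y hY using hglue
  refine ⟨max ρ₁ ρ₂, zero_lt_one.trans_le (hρ₁.trans (le_max_left _ _)), fun k ρ => Y ρ k,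
    fun k ρ _ hρ => ((hY ρ hρ).1 k).isSolutionODE hn0 hT hp, fun ρ _ hρ => (hY ρ hρ).2.1,
    fun ε hε => ?_⟩
  choose C hC using fun k =>
    IsSystemSolution.second_order hn hαT hphi (hrinj k) (hr k) (hrk k) rfl rfl hP2 hP3 hq hP
  have hC0 : 0 ≤ ∑ k, |C k| := Finset.sum_nonneg fun k _ => abs_nonneg _
  set η := ε / (n * (∑ k, |C k|) + 1) with hη
  have hη0 : 0 < η := by positivity
  have hPi : IntervalIntegrable P volume α T := hphi _
  have hb1 : ContinuousOn (beta1 n α P) (uIcc α T) := by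
    rw [uIcc_of_le hαT]
    exact continuousOn_const.mul (continuousOn_primitive hαT hPi)
  obtain ⟨M, hM0, hM⟩ := exists_forall_norm_integral_exp_le hαT
    (s := {P, fun t => P₃ t + P t * beta1 n α P t, q}) (by simp) (by
      rintro φ (rfl | rfl | rfl)
      exacts [hPi, (hphi _).add (hPi.mul_continuousOn hb1), hq]) hη0
  set D := ∑ i : Fin n × Fin n, 1 / ‖R i.2 / R i.1 - 1‖ with hD
  refine ⟨max (1 / η) (M * D), fun ρ _ hρ hρ₀ k ν hν x hx => ?_⟩
  have hρ1 : 1 ≤ ‖ρ‖ := hρ₁.trans ((le_max_left _ _).trans hρ)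
  have hρ0 : 0 < ‖ρ‖ := zero_lt_one.trans_le hρ1
  beta_reduce
  rw [(hY ρ hρ).2.2 k ν x hx]
  have hRL : ∀ j ≠ k, M ≤ ‖ρ * R k * (R j / R k - 1)‖ := by
    intro j hj
    have hne : 0 < ‖R j / R k - 1‖ := norm_pos_iff.2 fun h => hj (hrinj k (by
      simp only [hrk]; exact sub_eq_zero.1 h))
    have hle : 1 / ‖R j / R k - 1‖ ≤ D :=
      Finset.single_le_sum (f := fun i : Fin n × Fin n => 1 / ‖R i.2 / R i.1 - 1‖)
        (fun _ _ => by positivity) (Finset.mem_univ (k, j))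
    rw [norm_mul, hnorm, ← div_le_iff₀ hne, ← mul_one_div]
    exact (mul_le_mul_of_nonneg_left hle hM0).trans ((le_max_right _ _).trans hρ₀)
  have hw := hC k (ρ * R k) η (by rwa [hnorm]) (by
      rw [hnorm, one_div_le hρ0 hη0]; exact (le_max_left _ _).trans hρ₀)
    (fun j hj x hx φ hφ => hM φ hφ _ (hRL j hj) x hx) (whi ρ k)
    ((hwhi ρ ((le_max_left _ _).trans hρ)).1 k)
  refine (norm_systemTower_sub_le hn0 (hrinj k) (hr k) (hrk k) (fun j => hw j x hx) hν).trans ?_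
  rw [hnorm]
  refine le_of_le_of_eq (mul_le_mul_of_nonneg_right (b := n * (C k * η / ‖ρ‖ ^ 2))
    (c := ε / ‖ρ‖ ^ 2) ?_ (norm_nonneg _)) (div_mul_eq_mul_div _ _ _)
  rw [← mul_div_assoc]
  refine div_le_div_of_nonneg_right ?_ (by positivity)
  have hCk : C k ≤ ∑ k, |C k| := (le_abs_self _).trans
    (Finset.single_le_sum (f := fun k => |C k|) (fun k _ => abs_nonneg _) (Finset.mem_univ k))
  calc n * (C k * η) ≤ n * ((∑ k, |C k|) * η) := by gcongr
    _ ≤ (n * (∑ k, |C k|) + 1) * η := by linarith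
    _ = ε := by rw [hη]; field_simp
end
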